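/- arXiv:2404.06840 — 2 statements merged into one kernel-verified Lean document; each statement's English description precedes it below -/
import Mathlib

section
/- Let A be separable, α : qA → K⊗B with associated extension 0 → B₀ → E_α → A → 0 and splittings α_E, ᾱ_E as in the context, and suppose β′ : qE_α → K⊗C extends β : qB₀ → K⊗C up to homotopy (β homotopic to β′ ∘ q(j_E)). Let C₀ be the hereditary subalgebra of K⊗C generated by β′(qE_α), and let β′_E, β̄′_E : E_α → E_{β′} be the associated splittings. Then the *-homomorphism β ∘ q(α) : q²A → C₀ ⊆ K⊗C is homotopic to ω ∘ q(π_A), where ω : qA → C₀ ⊆ K⊗C is the homomorphism ω = q(β′_E α_E ⊕ β̄′_E ᾱ_E , β̄′_E α_E ⊕ β′_E ᾱ_E). -/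
/-! Statement 7 (Proposition 3.9 / `propomega`): with `α : qA → K⊗B`, the extension `0 → B₀ → E_α → A → 0` (splittings `α_E, ᾱ_E`), `β : qB₀ → K⊗C` extended up to homotopy by `β′ : qE_α → K⊗C`, and `C₀ ⊆ K⊗C` the hereditary subalgebra generated by `β′(qE_α)` with splittings `β′_E, β̄′_E : E_α → E_{β′}`, the homomorphism `β ∘ q(α) : q²A → C₀ ⊆ K⊗C` is homotopic to `ω ∘ q(π_A)` where `ω = q(β′_E α_E ⊕ β̄′_E ᾱ_E , β̄′_E α_E ⊕ β′_E ᾱ_E)`. -/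

noncomputable section
open scoped MultiplierAlgebra
/-- A presentation of the free product `Q = A ⋆ A` in the category of C*-algebras. -/
structure QPresentation (A Q : Type) [NonUnitalCStarAlgebra A] [NonUnitalCStarAlgebra Q] where
  ι : A →⋆ₙₐ[ℂ] Q
  ιbar : A →⋆ₙₐ[ℂ] Q
  free : ∀ (E : Type) [NonUnitalCStarAlgebra E] (f g : A →⋆ₙₐ[ℂ] E),
    ∃! h : Q →⋆ₙₐ[ℂ] E, h.comp ι = f ∧ h.comp ιbar = g

/-- The upper-left corner embedding `b ↦ diag(b, 0)` into `2×2` matrices. -/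
def cornerHom (B : Type) [NonUnitalSemiring B] [Module ℂ B] [StarRing B] :
    B →⋆ₙₐ[ℂ] Matrix (Fin 2) (Fin 2) B where
  toFun b := Matrix.of fun i k => if i = 0 ∧ k = 0 then b else 0
  map_add' x y := by
    ext i k
    simp only [Matrix.of_apply, Matrix.add_apply]
    split_ifs <;> simp
  map_smul' c x := by
    ext i k
    simp only [Matrix.of_apply, Matrix.smul_apply]
    split_ifs <;> simp
  map_zero' := by
    ext i k
    simp
  map_mul' x y := by
    ext i k
    simp only [Matrix.of_apply, Matrix.mul_apply, Fin.sum_univ_two]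
    fin_cases i <;> fin_cases k <;> simp
  map_star' x := by
    ext i k
    simp only [Matrix.star_apply, Matrix.of_apply]
    fin_cases i <;> fin_cases k <;> simp

/-- The entrywise application of a *-homomorphism to `2×2` matrices. -/
def matMap₂ {X Y : Type} [NonUnitalSemiring X] [Module ℂ X] [StarRing X]
    [NonUnitalSemiring Y] [Module ℂ Y] [StarRing Y] (f : X →⋆ₙₐ[ℂ] Y) :
    Matrix (Fin 2) (Fin 2) X →⋆ₙₐ[ℂ] Matrix (Fin 2) (Fin 2) Y where
  toFun M := M.map f
  map_add' x y := by ext i k; simp [Matrix.map_apply]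
  map_smul' c x := by ext i k; simp [Matrix.map_apply]
  map_zero' := by ext i k; simp [Matrix.map_apply]
  map_mul' x y := by
    ext i k
    simp [Matrix.map_apply, Matrix.mul_apply]
  map_star' x := by
    ext i k
    simp [Matrix.map_apply, Matrix.star_apply, map_star]

/-- Homotopy of *-homomorphisms: a point-norm continuous path of *-homomorphisms. -/
def HomHomotopic {X Y : Type} [NonUnitalCStarAlgebra X] [NonUnitalNonAssocSemiring Y]
    [DistribMulAction ℂ Y] [Star Y] [TopologicalSpace Y] (f g : X →⋆ₙₐ[ℂ] Y) : Prop :=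
  ∃ H : unitInterval → (X →⋆ₙₐ[ℂ] Y),
    (∀ x : X, Continuous fun t => H t x) ∧ H 0 = f ∧ H 1 = g

/-- The embedding `b ↦ (b)` of an algebra into `1×1` matrices. -/
def one₁ (B : Type) [NonUnitalSemiring B] [Module ℂ B] [StarRing B] :
    B →⋆ₙₐ[ℂ] Matrix (Fin 1) (Fin 1) B where
  toFun b := Matrix.of fun _ _ => b
  map_add' x y := by ext i k; rfl
  map_smul' c x := by ext i k; rfl
  map_zero' := by ext i k; rfl
  map_mul' x y := by ext i k; simp [Matrix.mul_apply]
  map_star' x := by ext i k; rfl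

/-- A presentation of the stabilization `K ⊗ B` (`K` = compact operators on `ℓ²(ℕ)`):
`KB` is the closure of the increasing union of the matrix algebras `Mₙ(B)` under
the upper-left corner embeddings. -/
structure Stabilization (B KB : Type) [NonUnitalCStarAlgebra B] [NonUnitalCStarAlgebra KB] where
  j : ∀ n : ℕ, (Matrix (Fin n) (Fin n) B →⋆ₙₐ[ℂ] KB)
  inj : ∀ n, Function.Injective (j n)
  compat : ∀ (n : ℕ) (M : Matrix (Fin n) (Fin n) B),
    j (n + 1) (Matrix.of fun i k =>
      if h : (i : ℕ) < n ∧ (k : ℕ) < n then M ⟨i, h.1⟩ ⟨k, h.2⟩ else 0) = j n M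
  dense : closure (⋃ n, Set.range (j n)) = Set.univ

/-- The canonical corner embedding `B → K ⊗ B`. -/
def Stabilization.corner {B KB : Type} [NonUnitalCStarAlgebra B] [NonUnitalCStarAlgebra KB]
    (St : Stabilization B KB) : B →⋆ₙₐ[ℂ] KB :=
  (St.j 1).comp (one₁ B)

/-- The data attached to a homomorphism `α : qA → K ⊗ B` (Cuntz–Gabe §3.3):
the hereditary subalgebra `B₀ ⊆ K⊗B` generated by `α(qA)` (presented via `jB₀`),
the canonical extension `α° : QA → 𝓜(B₀)`, the subalgebra
`E_α = C*(B₀, α_E(A), ᾱ_E(A)) ⊆ 𝓜(B₀) ⊕ A` (presented via `jE`), the two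
splittings `α_E, ᾱ_E : A → E_α` given by `α_E(x) = (α°(ι x), x)`,
`ᾱ_E(x) = (α°(ῑ x), x)`, and the inclusion `j_E : B₀ → E_α`.
This yields the exact sequence `0 → B₀ → E_α → A → 0` with splittings `α_E, ᾱ_E`,
and `α = q(α_E, ᾱ_E)`. -/
structure EalphaData (A QA qA : Type)
    [NonUnitalCStarAlgebra A] [NonUnitalCStarAlgebra QA] [NonUnitalCStarAlgebra qA]
    (P₁ : QPresentation A QA) (j₁ : qA →⋆ₙₐ[ℂ] QA)
    (KB : Type) [NonUnitalCStarAlgebra KB] (α : qA →⋆ₙₐ[ℂ] KB)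
    (B₀T EαT : Type) [NonUnitalCStarAlgebra B₀T] [NonUnitalCStarAlgebra EαT] where
  jB₀ : B₀T →⋆ₙₐ[ℂ] KB
  hjB₀inj : Function.Injective jB₀
  hjB₀r : Set.range jB₀ = closure ((Submodule.span ℂ
    {x : KB | ∃ z w : qA, ∃ b : KB, x = α z * b * α w} : Submodule ℂ KB) : Set KB)
  αext : QA →⋆ₙₐ[ℂ] 𝓜(ℂ, B₀T)
  hαext : ∀ (z : qA) (u : B₀T), jB₀ u = α z → αext (j₁ z) = (u : 𝓜(ℂ, B₀T))
  jE : EαT →⋆ₙₐ[ℂ] (𝓜(ℂ, B₀T) × A)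
  hjEinj : Function.Injective jE
  hjEr : Set.range jE = ((NonUnitalStarAlgebra.adjoin ℂ
      ({p : 𝓜(ℂ, B₀T) × A | ∃ b : B₀T, p = ((b : 𝓜(ℂ, B₀T)), 0)} ∪
       {p : 𝓜(ℂ, B₀T) × A | ∃ x : A, p = (αext (P₁.ι x), x)} ∪
       {p : 𝓜(ℂ, B₀T) × A | ∃ x : A, p = (αext (P₁.ιbar x), x)})).topologicalClosure :
    Set (𝓜(ℂ, B₀T) × A))
  αE : A →⋆ₙₐ[ℂ] EαT
  hαE : ∀ x, jE (αE x) = (αext (P₁.ι x), x)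
  αbarE : A →⋆ₙₐ[ℂ] EαT
  hαbarE : ∀ x, jE (αbarE x) = (αext (P₁.ιbar x), x)
  jEB : B₀T →⋆ₙₐ[ℂ] EαT
  hjEB : ∀ b, jE (jEB b) = ((b : 𝓜(ℂ, B₀T)), 0)

section Mat
open Matrix

theorem s7_norm_le {X D D' : Type} [NonUnitalCStarAlgebra X] [NonUnitalCStarAlgebra D]
    [NonUnitalCStarAlgebra D'] (f : X →⋆ₙₐ[ℂ] D) (j : X →⋆ₙₐ[ℂ] D')
    (hj : Function.Injective j) (M : X) : ‖f M‖ ≤ ‖j M‖ :=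
  (NonUnitalStarAlgHom.norm_apply_le f M).trans (NonUnitalStarAlgHom.norm_map j hj M).ge

theorem s7_continuous {X D : Type} [NonUnitalCStarAlgebra X] [NonUnitalCStarAlgebra D]
    (f : X →⋆ₙₐ[ℂ] D) : Continuous f :=
  AddMonoidHomClass.continuous_of_bound f 1
    (by simpa only [one_mul] using NonUnitalStarAlgHom.norm_apply_le f)

theorem s7_mat_norm_le {n : ℕ} {C D D' : Type} [NonUnitalCStarAlgebra C] [NonUnitalCStarAlgebra D]
    [NonUnitalCStarAlgebra D']
    (f : Matrix (Fin n) (Fin n) C →⋆ₙₐ[ℂ] D) (j : Matrix (Fin n) (Fin n) C →⋆ₙₐ[ℂ] D')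
    (hj : Function.Injective j) (M : Matrix (Fin n) (Fin n) C) : ‖f M‖ ≤ ‖j M‖ := by
  let _ : PartialOrder C := CStarAlgebra.spectralOrder C
  have _ : StarOrderedRing C := CStarAlgebra.spectralOrderedRing C
  exact s7_norm_le (X := CStarMatrix (Fin n) (Fin n) C) f j hj M

theorem s7_mat_continuous {n : ℕ} {C D : Type} [NonUnitalCStarAlgebra C] [NonUnitalCStarAlgebra D]
    (f : Matrix (Fin n) (Fin n) C →⋆ₙₐ[ℂ] D) : Continuous f := by
  let _ : PartialOrder C := CStarAlgebra.spectralOrder C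
  have _ : StarOrderedRing C := CStarAlgebra.spectralOrderedRing C
  exact s7_continuous (X := CStarMatrix (Fin n) (Fin n) C) f

theorem s7_free_ext {A Q D : Type} [NonUnitalCStarAlgebra A] [NonUnitalCStarAlgebra Q]
    [NonUnitalCStarAlgebra D] (P : QPresentation A Q) (f g : Q →⋆ₙₐ[ℂ] D)
    (h1 : ∀ x, f (P.ι x) = g (P.ι x)) (h2 : ∀ x, f (P.ιbar x) = g (P.ιbar x)) : f = g := by
  obtain ⟨h, _, hu⟩ := P.free D (f.comp P.ι) (f.comp P.ιbar)
  rw [hu f ⟨rfl, rfl⟩, hu g ⟨?_, ?_⟩]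
  · ext x; exact (h1 x).symm
  · ext x; exact (h2 x).symm

theorem s7_free_ext_mat {n : ℕ} {A Q D : Type} [NonUnitalCStarAlgebra A] [NonUnitalCStarAlgebra Q]
    [NonUnitalCStarAlgebra D] (P : QPresentation A Q) (f g : Q →⋆ₙₐ[ℂ] Matrix (Fin n) (Fin n) D)
    (h1 : ∀ x, f (P.ι x) = g (P.ι x)) (h2 : ∀ x, f (P.ιbar x) = g (P.ιbar x)) : f = g := by
  let _ : PartialOrder D := CStarAlgebra.spectralOrder D
  have _ : StarOrderedRing D := CStarAlgebra.spectralOrderedRing D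
  exact s7_free_ext (D := CStarMatrix (Fin n) (Fin n) D) P f g h1 h2

theorem s7_free_ex {A Q D : Type} [NonUnitalCStarAlgebra A] [NonUnitalCStarAlgebra Q]
    [NonUnitalCStarAlgebra D] (P : QPresentation A Q) (f g : A →⋆ₙₐ[ℂ] D) :
    ∃ h : Q →⋆ₙₐ[ℂ] D, (∀ x, h (P.ι x) = f x) ∧ (∀ x, h (P.ιbar x) = g x) := by
  obtain ⟨h, ⟨h1, h2⟩, _⟩ := P.free D f g
  exact ⟨h, fun x => DFunLike.congr_fun h1 x, fun x => DFunLike.congr_fun h2 x⟩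

theorem s7_free_ex_mat {n : ℕ} {A Q D : Type} [NonUnitalCStarAlgebra A] [NonUnitalCStarAlgebra Q]
    [NonUnitalCStarAlgebra D] (P : QPresentation A Q) (f g : A →⋆ₙₐ[ℂ] Matrix (Fin n) (Fin n) D) :
    ∃ h : Q →⋆ₙₐ[ℂ] Matrix (Fin n) (Fin n) D,
      (∀ x, h (P.ι x) = f x) ∧ (∀ x, h (P.ιbar x) = g x) := by
  let _ : PartialOrder D := CStarAlgebra.spectralOrder D
  have _ : StarOrderedRing D := CStarAlgebra.spectralOrderedRing D
  exact s7_free_ex (D := CStarMatrix (Fin n) (Fin n) D) P f g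

end Mat

section Homotopy
variable {X Y Z : Type} [NonUnitalCStarAlgebra X] [NonUnitalNonAssocSemiring Y]
    [DistribMulAction ℂ Y] [Star Y] [TopologicalSpace Y]

theorem s7_symm {f g : X →⋆ₙₐ[ℂ] Y} (h : HomHomotopic f g) : HomHomotopic g f := by
  obtain ⟨H, hc, h0, h1⟩ := h
  exact ⟨fun t => H (unitInterval.symm t),
    fun x => (hc x).comp unitInterval.continuous_symm, by simpa, by simpa⟩

theorem s7_trans {f g k : X →⋆ₙₐ[ℂ] Y} (h : HomHomotopic f g) (h' : HomHomotopic g k) :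
    HomHomotopic f k := by
  obtain ⟨H, hc, h0, h1⟩ := h
  obtain ⟨H', hc', h0', h1'⟩ := h'
  refine ⟨fun t => if (t : ℝ) ≤ 1/2 then H (Set.projIcc 0 1 zero_le_one (2 * (t:ℝ)))
    else H' (Set.projIcc 0 1 zero_le_one (2 * (t:ℝ) - 1)), fun x => ?_, ?_, ?_⟩
  · have : (fun t : unitInterval => (if (t : ℝ) ≤ 1/2
      then H (Set.projIcc 0 1 zero_le_one (2 * (t:ℝ)))
      else H' (Set.projIcc 0 1 zero_le_one (2 * (t:ℝ) - 1))) x) =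
      fun t : unitInterval => if (t : ℝ) ≤ 1/2
      then H (Set.projIcc 0 1 zero_le_one (2 * (t:ℝ))) x
      else H' (Set.projIcc 0 1 zero_le_one (2 * (t:ℝ) - 1)) x := by
      funext t; split_ifs <;> rfl
    rw [this]
    refine Continuous.if_le ?_ ?_ (by fun_prop) (by fun_prop) ?_
    · exact (hc x).comp (continuous_projIcc.comp (by fun_prop))
    · exact (hc' x).comp (continuous_projIcc.comp (by fun_prop))
    · intro t ht
      rw [ht]
      have e1 : Set.projIcc (0:ℝ) 1 zero_le_one (2 * (1/2)) = 1 := by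
        rw [show (2 * (1/2) : ℝ) = 1 by norm_num]; exact Set.projIcc_right ..
      have e2 : Set.projIcc (0:ℝ) 1 zero_le_one (2 * (1/2) - 1) = 0 := by
        rw [show (2 * (1/2) - 1: ℝ) = 0 by norm_num]; exact Set.projIcc_left ..
      rw [e1, e2, h1, h0']
  · have e1 : Set.projIcc (0:ℝ) 1 zero_le_one 0 = 0 := Set.projIcc_left ..
    simp [h0]
  · have e1 : Set.projIcc (0:ℝ) 1 zero_le_one (2-1) = 1 := by
        rw [show (2 - 1 : ℝ) = 1 by norm_num]; exact Set.projIcc_right ..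
    have : ¬ ((1:ℝ) ≤ 1/2) := by norm_num
    simp only [Set.Icc.coe_one, this, if_false, mul_one, e1, h1']

theorem s7_comp_right [NonUnitalCStarAlgebra Z] {f g : X →⋆ₙₐ[ℂ] Y} (h : HomHomotopic f g)
    (k : Z →⋆ₙₐ[ℂ] X) : HomHomotopic (f.comp k) (g.comp k) := by
  obtain ⟨H, hc, h0, h1⟩ := h
  exact ⟨fun t => (H t).comp k, fun x => hc (k x), by simp only [h0], by simp only [h1]⟩

theorem s7_comp_left [NonUnitalNonAssocSemiring Z]
    [DistribMulAction ℂ Z] [Star Z] [TopologicalSpace Z] {f g : X →⋆ₙₐ[ℂ] Y} (h : HomHomotopic f g)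
    (k : Y →⋆ₙₐ[ℂ] Z) (hk : Continuous k) : HomHomotopic (k.comp f) (k.comp g) := by
  obtain ⟨H, hc, h0, h1⟩ := h
  exact ⟨fun t => k.comp (H t), fun x => hk.comp (hc x), by simp only [h0], by simp only [h1]⟩

end Homotopy

section Stab
open Matrix

variable {C KC : Type} [NonUnitalCStarAlgebra C] [NonUnitalCStarAlgebra KC]

/-- Extension by zero of a finite matrix. -/
def s7ext {n : ℕ} (M : Matrix (Fin n) (Fin n) C) : ℕ → ℕ → C := fun i k =>
  if h : i < n ∧ k < n then M ⟨i, h.1⟩ ⟨k, h.2⟩ else 0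

/-- Truncation of an infinite matrix, mapped to the stabilization. -/
def s7J (St : Stabilization C KC) (n : ℕ) (X : ℕ → ℕ → C) : KC :=
  St.j n (Matrix.of fun i k => X i k)

theorem s7J_ext (St : Stabilization C KC) {n : ℕ} (M : Matrix (Fin n) (Fin n) C) :
    s7J St n (s7ext M) = St.j n M := by
  unfold s7J s7ext
  congr 1
  ext i k
  simp

theorem s7J_succ (St : Stabilization C KC) {n : ℕ} (X : ℕ → ℕ → C)
    (hX : ∀ i k, ¬ (i < n ∧ k < n) → X i k = 0) : s7J St (n+1) X = s7J St n X := by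
  unfold s7J
  rw [← St.compat n]
  congr 1
  ext i k
  simp only [of_apply]
  split_ifs with h
  · rfl
  · exact hX _ _ h

theorem s7J_le (St : Stabilization C KC) {n m : ℕ} (h : n ≤ m) (X : ℕ → ℕ → C)
    (hX : ∀ i k, ¬ (i < n ∧ k < n) → X i k = 0) : s7J St m X = s7J St n X := by
  induction m, h using Nat.le_induction with
  | base => rfl
  | succ m hm ih =>
    rw [s7J_succ, ih]
    intro i k hik
    apply hX
    omega

theorem s7J_raise (St : Stabilization C KC) {n m : ℕ} (h : n ≤ m) (M : Matrix (Fin n) (Fin n) C) :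
    St.j m (Matrix.of fun i k => s7ext M i k) = St.j n M := by
  rw [← s7J_ext St M, ← s7J_le St h]
  · rfl
  · intro i k hik
    simp [s7ext, hik]

theorem s7_lift (St : Stabilization C KC) {D : Type} [NonUnitalCStarAlgebra D]
    (f : ∀ n, Matrix (Fin n) (Fin n) C →ₗ[ℂ] D)
    (hc : ∀ n (M : Matrix (Fin n) (Fin n) C), f (n+1) (Matrix.of fun i k => s7ext M i k) = f n M)
    (hb : ∀ n M, ‖f n M‖ ≤ ‖St.j n M‖) :
    ∃ S : KC →L[ℂ] D, ∀ n M, S (St.j n M) = f n M := by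
  have hr : ∀ n m (h : n ≤ m) (M : Matrix (Fin n) (Fin n) C),
      f m (Matrix.of fun i k => s7ext M i k) = f n M := by
    intro n m h M
    induction m, h using Nat.le_induction with
    | base => congr 1; ext i k; simp [s7ext]
    | succ m hm ih =>
      rw [← ih, ← hc m]
      congr 1
      ext i k
      simp only [of_apply, s7ext]
      by_cases h : (i:ℕ) < n ∧ (k : ℕ) < n
      · have : (i:ℕ) < m ∧ (k : ℕ) < m := by omega
        simp [h, this]
      · simp [h]
  have hwd' : ∀ n (M M' : Matrix (Fin n) (Fin n) C), St.j n M = St.j n M' → f n M = f n M' := by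
    intro n M M' h
    have := hb n (M - M')
    rw [map_sub, map_sub, h, sub_self, norm_zero] at this
    exact sub_eq_zero.mp (norm_le_zero_iff.mp this)
  have hwd : ∀ n m (M : Matrix (Fin n) (Fin n) C) (M' : Matrix (Fin m) (Fin m) C),
      St.j n M = St.j m M' → f n M = f m M' := by
    intro n m M M' h
    rw [← hr n _ (le_max_left n m), ← hr m _ (le_max_right n m)]
    apply hwd'
    rw [s7J_raise St (le_max_left n m), s7J_raise St (le_max_right n m), h]
  let R : Submodule ℂ KC :=
    { carrier := {x | ∃ n M, St.j n M = x}
      add_mem' := by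
        rintro x y ⟨n, M, rfl⟩ ⟨m, M', rfl⟩
        refine ⟨max n m, (Matrix.of fun (i k : Fin (max n m)) => s7ext M i k) + Matrix.of fun (i k : Fin (max n m)) => s7ext M' i k, ?_⟩
        rw [map_add, s7J_raise St (le_max_left n m), s7J_raise St (le_max_right n m)]
      zero_mem' := ⟨0, 0, map_zero _⟩
      smul_mem' := by
        rintro c x ⟨n, M, rfl⟩
        exact ⟨n, c • M, map_smul _ _ _⟩ }
  have hR : ∀ r : R, ∃ d : D, ∀ n M, St.j n M = r → f n M = d := by
    rintro ⟨x, n, M, rfl⟩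
    exact ⟨f n M, fun n' M' h => hwd _ _ _ _ h⟩
  choose g hg using hR
  let G : R →ₗ[ℂ] D :=
    { toFun := g
      map_add' := by
        rintro ⟨x, n, M, rfl⟩ ⟨y, m, M', rfl⟩
        rw [← hg ⟨_, n, M, rfl⟩ n M rfl, ← hg ⟨_, m, M', rfl⟩ m M' rfl]
        rw [← hg _ (max n m)
          ((Matrix.of fun (i k : Fin (max n m)) => s7ext M i k) + Matrix.of fun (i k : Fin (max n m)) => s7ext M' i k), map_add,
          hr _ _ (le_max_left n m), hr _ _ (le_max_right n m)]
        rw [map_add, s7J_raise St (le_max_left n m), s7J_raise St (le_max_right n m)]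
        rfl
      map_smul' := by
        rintro c ⟨x, n, M, rfl⟩
        rw [← hg ⟨_, n, M, rfl⟩ n M rfl, ← hg _ n (c • M), map_smul]
        · rfl
        · rw [map_smul]; rfl }
  have hG : ∀ n M (h : St.j n M ∈ R), G ⟨St.j n M, h⟩ = f n M := fun n M h => (hg _ n M rfl).symm
  have hGb : ∀ r : R, ‖G r‖ ≤ 1 * ‖r‖ := by
    rintro ⟨x, n, M, rfl⟩
    rw [hG, one_mul]
    exact hb n M
  let G' : R →L[ℂ] D := G.mkContinuous 1 hGb
  have hd : DenseRange R.subtypeL := by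
    have h := St.dense
    have : Set.range R.subtypeL = ⋃ n, Set.range (St.j n) := by
      ext x
      simp only [Submodule.coe_subtypeL, Submodule.coe_subtype, Subtype.range_coe_subtype,
        Set.mem_iUnion, Set.mem_range]
      rfl
    rw [DenseRange, this, dense_iff_closure_eq]
    exact h
  have hu : IsUniformInducing R.subtypeL := isUniformEmbedding_subtype_val.isUniformInducing
  refine ⟨G'.extend R.subtypeL, fun n M => ?_⟩
  have := ContinuousLinearMap.extend_eq G' hd hu ⟨St.j n M, n, M, rfl⟩
  exact this.trans (hG _ _ _)

/-- The matrix `V M V'ᵀ`. -/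
def s7cj (V V' : ℕ → ℕ → ℝ) (n : ℕ) (M : Matrix (Fin n) (Fin n) C) : ℕ → ℕ → C := fun i i' =>
  ∑ k : Fin n, ∑ l : Fin n, ((V i k * V' i' l : ℝ) : ℂ) • M k l

/-- support condition on columns -/
def s7supp (V : ℕ → ℕ → ℝ) : Prop := ∀ k i, (k+3)^2 ≤ i → V i k = 0

/-- the columns satisfy `V* V' = γ` -/
def s7Gr (γ : ℝ) (V V' : ℕ → ℕ → ℝ) : Prop := ∀ n k l m, k < n → l < n → (n+2)^2 ≤ m →
  ∑ p ∈ Finset.range m, V p k * V' p l = if k = l then γ else 0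

theorem s7supp_lt {V : ℕ → ℕ → ℝ} (h : s7supp V) {n k i : ℕ} (hk : k < n) (hi : (n+2)^2 ≤ i) :
    V i k = 0 := by
  apply h
  refine le_trans (Nat.pow_le_pow_left ?_ 2) hi
  omega

theorem s7cj_supp {V V' : ℕ → ℕ → ℝ} (h : s7supp V) (h' : s7supp V') (n : ℕ)
    (M : Matrix (Fin n) (Fin n) C) (i k : ℕ) (hik : ¬ (i < (n+2)^2 ∧ k < (n+2)^2)) :
    s7cj V V' n M i k = 0 := by
  unfold s7cj
  refine Finset.sum_eq_zero fun a _ => Finset.sum_eq_zero fun b _ => ?_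
  rcases not_and_or.mp hik with h1 | h1
  · rw [s7supp_lt h a.2 (not_lt.mp h1)]; simp
  · rw [s7supp_lt h' b.2 (not_lt.mp h1)]; simp

theorem s7J_mul (St : Stabilization C KC) (γ : ℝ) {V V' V'' V''' : ℕ → ℕ → ℝ} (h : s7Gr γ V' V'')
    (n m : ℕ) (hm : (n+2)^2 ≤ m) (M M' : Matrix (Fin n) (Fin n) C) :
    s7J St m (s7cj V V' n M) * s7J St m (s7cj V'' V''' n M') =
      (γ : ℂ) • s7J St m (s7cj V V''' n (M * M')) := by
  unfold s7J
  rw [← map_mul, ← map_smul]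
  congr 1
  ext i i'
  simp only [Matrix.mul_apply, of_apply, Matrix.smul_apply, s7cj]
  have e : ∀ p : Fin m,
      (∑ k : Fin n, ∑ l : Fin n, ((V i k * V' p l : ℝ) : ℂ) • M k l) *
      (∑ k' : Fin n, ∑ l' : Fin n, ((V'' p k' * V''' i' l' : ℝ) : ℂ) • M' k' l') =
      ∑ k : Fin n, ∑ l' : Fin n, ∑ l : Fin n, ∑ k' : Fin n,
        ((V i k * V''' i' l' : ℝ) : ℂ) • ((V' p l * V'' p k' : ℝ) : ℂ) • (M k l * M' k' l') := by
    intro p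
    rw [Finset.sum_mul]
    refine Finset.sum_congr rfl fun k _ => ?_
    rw [Finset.sum_mul]
    conv_rhs => rw [Finset.sum_comm]
    refine Finset.sum_congr rfl fun l _ => ?_
    conv_rhs => rw [Finset.sum_comm]
    rw [Finset.mul_sum]
    refine Finset.sum_congr rfl fun k' _ => ?_
    rw [Finset.mul_sum]
    refine Finset.sum_congr rfl fun l' _ => ?_
    rw [smul_mul_smul_comm, smul_smul]
    congr 1
    push_cast; ring
  simp_rw [e]
  rw [Finset.sum_comm, Finset.smul_sum]
  refine Finset.sum_congr rfl fun k _ => ?_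
  rw [Finset.sum_comm, Finset.smul_sum]
  refine Finset.sum_congr rfl fun l' _ => ?_
  rw [Finset.sum_comm, Finset.smul_sum, Finset.smul_sum]
  refine Finset.sum_congr rfl fun l _ => ?_
  rw [Finset.sum_comm]
  simp_rw [← Finset.smul_sum, ← Finset.sum_smul]
  have e2 : ∀ k' : Fin n, (∑ p : Fin m, ((V' p l * V'' p k' : ℝ) : ℂ)) =
      if l = k' then (γ : ℂ) else 0 := by
    intro k'
    have := h n l k' m l.2 k'.2 hm
    rw [Finset.sum_range] at this
    rw [← Complex.ofReal_sum, this]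
    simp only [Fin.ext_iff]
    split_ifs <;> simp
  simp_rw [e2]
  simp only [ite_smul, zero_smul, Finset.sum_ite_eq, Finset.mem_univ, if_true]
  rw [smul_comm]

theorem s7J_star (St : Stabilization C KC) (V V' : ℕ → ℕ → ℝ)
    (n m : ℕ) (M : Matrix (Fin n) (Fin n) C) :
    star (s7J St m (s7cj V V' n M)) = s7J St m (s7cj V' V n (star M)) := by
  unfold s7J
  rw [← map_star]
  congr 1
  ext i i'
  simp only [Matrix.star_apply, of_apply, s7cj, star_sum, star_smul]
  rw [Finset.sum_comm]
  refine Finset.sum_congr rfl fun k _ => ?_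
  refine Finset.sum_congr rfl fun l _ => ?_
  congr 1
  simp [mul_comm]

theorem s7J_add (St : Stabilization C KC) (V V' : ℕ → ℕ → ℝ)
    (n m : ℕ) (M M' : Matrix (Fin n) (Fin n) C) :
    s7J St m (s7cj V V' n (M + M')) = s7J St m (s7cj V V' n M) + s7J St m (s7cj V V' n M') := by
  unfold s7J
  rw [← map_add]
  congr 1
  ext i i'
  simp [s7cj, Finset.sum_add_distrib]

theorem s7J_smul (St : Stabilization C KC) (V V' : ℕ → ℕ → ℝ)
    (n m : ℕ) (c : ℂ) (M : Matrix (Fin n) (Fin n) C) :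
    s7J St m (s7cj V V' n (c • M)) = c • s7J St m (s7cj V V' n M) := by
  unfold s7J
  rw [← map_smul]
  congr 1
  ext i i'
  simp only [s7cj, of_apply, Matrix.smul_apply, Finset.smul_sum]
  refine Finset.sum_congr rfl fun k _ => ?_
  refine Finset.sum_congr rfl fun l _ => ?_
  rw [smul_comm]

theorem s7_S_ex (St : Stabilization C KC) {V V' : ℕ → ℕ → ℝ} (h : s7supp V) (h' : s7supp V')
    (g : s7Gr 1 V V) (g' : s7Gr 1 V' V') : ∃ S : KC →L[ℂ] KC,
    ∀ n (M : Matrix (Fin n) (Fin n) C) m, (n+2)^2 ≤ m → S (St.j n M) = s7J St m (s7cj V V' n M) := by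
  let f : ∀ n, Matrix (Fin n) (Fin n) C →ₗ[ℂ] KC := fun n =>
    { toFun := fun M => s7J St ((n+2)^2) (s7cj V V' n M)
      map_add' := s7J_add St V V' n _
      map_smul' := s7J_smul St V V' n _ }
  have hb : ∀ n M, ‖f n M‖ ≤ ‖St.j n M‖ := by
    intro n M
    let φ : Matrix (Fin n) (Fin n) C →⋆ₙₐ[ℂ] KC :=
      { toFun := fun M => s7J St ((n+2)^2) (s7cj V V n M)
        map_add' := s7J_add St V V n _
        map_smul' := s7J_smul St V V n _
        map_zero' := by
          have := s7J_smul St V V n ((n+2)^2) 0 0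
          rwa [zero_smul, zero_smul] at this
        map_mul' := fun x y => by
          rw [s7J_mul St 1 g n _ le_rfl]; simp
        map_star' := fun x => (s7J_star St V V n _ x).symm }
    have e : f n M * star (f n M) = φ (M * star M) := by
      change s7J St _ (s7cj V V' n M) * star (s7J St _ (s7cj V V' n M)) = _
      rw [s7J_star, s7J_mul St 1 g' n _ le_rfl]
      rw [Complex.ofReal_one, one_smul]; rfl
    have h1 := s7_mat_norm_le φ (St.j n) (St.inj n) (M * star M)
    rw [← e, CStarRing.norm_self_mul_star, map_mul, map_star, CStarRing.norm_self_mul_star] at h1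
    exact le_of_sq_le_sq (by simpa [sq] using h1) (norm_nonneg _)
  have hc : ∀ n (M : Matrix (Fin n) (Fin n) C),
      f (n+1) (Matrix.of fun i k => s7ext M i k) = f n M := by
    intro n M
    change s7J St _ (s7cj V V' (n+1) _) = s7J St _ (s7cj V V' n _)
    have e : s7cj V V' (n+1) (Matrix.of fun i k => s7ext M i k) = s7cj V V' n M := by
      funext i i'
      unfold s7cj
      rw [Fin.sum_univ_castSucc]
      simp [Fin.sum_univ_castSucc, s7ext]
    rw [e, s7J_le St _ _ (s7cj_supp h h' n M)]
    exact Nat.pow_le_pow_left (by omega) 2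
  obtain ⟨S, hS⟩ := s7_lift St f hc hb
  refine ⟨S, fun n M m hm => ?_⟩
  rw [hS, s7J_le St hm _ (s7cj_supp h h' n M)]
  rfl

theorem s7_ind (St : Stabilization C KC) {p : KC → Prop} (hp : IsClosed {x | p x})
    (h : ∀ n M, p (St.j n M)) (x : KC) : p x := by
  have hx : x ∈ closure (⋃ n, Set.range (St.j n)) := by rw [St.dense]; trivial
  have : closure (⋃ n, Set.range (St.j n)) ⊆ {x | p x} := by
    apply closure_minimal _ hp
    rintro _ ⟨_, ⟨n, rfl⟩, M, rfl⟩
    exact h n M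
  exact this hx

end Stab

section Rot

/-- auxiliary vectors -/
def s7u (c s : ℝ) : ℕ → ℕ → ℝ
  | 0, i => if i = 0 then 1 else 0
  | (k+1), i => -s * s7u c s k i + if i = k + 1 then c else 0

/-- columns of the isometry -/
def s7v (c s : ℝ) (k i : ℕ) : ℝ := c * s7u c s k i + if i = k + 1 then s else 0

theorem s7u_zero (c s : ℝ) (k i : ℕ) (h : k < i) : s7u c s k i = 0 := by
  induction k with
  | zero => simp [s7u]; omega
  | succ k ih => simp [s7u, ih (by omega)]; omega

theorem s7v_zero (c s : ℝ) (k i : ℕ) (h : k + 1 < i) : s7v c s k i = 0 := by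
  simp [s7v, s7u_zero c s k i (by omega)]; omega

theorem s7_sum_single (K q : ℕ) (h : q < K) (x : ℕ → ℝ) (a : ℝ) :
    ∑ b ∈ Finset.range K, x b * (if b = q then a else 0) = x q * a := by
  simp [h]

theorem s7_uu (c s : ℝ) (hcs : c^2 + s^2 = 1) (K k : ℕ) (h : k < K) :
    ∑ b ∈ Finset.range K, s7u c s k b * s7u c s k b = 1 := by
  induction k with
  | zero =>
    simp only [s7u]
    rw [s7_sum_single K 0 h]; simp
  | succ k ih =>
    have e : ∀ b, s7u c s (k+1) b * s7u c s (k+1) b =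
      s^2 * (s7u c s k b * s7u c s k b) + (-2*s* s7u c s k b) * (if b = k+1 then c else 0)
       + c * (if b = k+1 then c else 0) := by
      intro b; simp only [s7u]; split_ifs <;> ring
    simp_rw [e]
    rw [Finset.sum_add_distrib, Finset.sum_add_distrib, ← Finset.mul_sum, ih (by omega),
      s7_sum_single K (k+1) h, s7_sum_single K (k+1) h (fun _ => c), s7u_zero c s k _ (by omega)]
    nlinarith

theorem s7_vu (c s : ℝ) (hcs : c^2 + s^2 = 1) (K j k : ℕ) (hj : j < k) (h : k < K) :
    ∑ b ∈ Finset.range K, s7v c s j b * s7u c s k b = 0 := by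
  induction k with
  | zero => omega
  | succ k ih =>
    have e : ∀ b, s7v c s j b * s7u c s (k+1) b =
      -s * (s7v c s j b * s7u c s k b) + s7v c s j b * (if b = k+1 then c else 0) := by
      intro b; simp only [s7u]; ring
    simp_rw [e]
    rw [Finset.sum_add_distrib, ← Finset.mul_sum, s7_sum_single K (k+1) h]
    rcases Nat.lt_or_ge j k with hjk | hjk
    · rw [ih hjk (by omega), s7v_zero c s j _ (by omega)]; simp
    · obtain rfl : j = k := by omega
      have e2 : ∀ b, s7v c s j b * s7u c s j b =
        c * (s7u c s j b * s7u c s j b) + s7u c s j b * (if b = j+1 then s else 0) := by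
        intro b; simp only [s7v]; ring
      simp_rw [e2]
      rw [Finset.sum_add_distrib, ← Finset.mul_sum, s7_sum_single K (j+1) h,
        s7_uu c s hcs K j (by omega), s7u_zero c s j _ (by omega)]
      simp [s7v, s7u_zero c s j (j+1) (by omega)]

theorem s7_vv_lt (c s : ℝ) (hcs : c^2 + s^2 = 1) (K j k : ℕ) (hj : j < k) (h : k + 1 < K) :
    ∑ b ∈ Finset.range K, s7v c s j b * s7v c s k b = 0 := by
  have e : ∀ b, s7v c s j b * s7v c s k b =
      c * (s7v c s j b * s7u c s k b) + s7v c s j b * (if b = k+1 then s else 0) := by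
    intro b; simp only [s7v]; ring
  simp_rw [e]
  rw [Finset.sum_add_distrib, ← Finset.mul_sum, s7_sum_single K (k+1) h,
    s7_vu c s hcs K j k hj (by omega), s7v_zero c s j _ (by omega)]
  simp

theorem s7_vv (c s : ℝ) (hcs : c^2 + s^2 = 1) (K j k : ℕ) (hj : j + 1 < K) (h : k + 1 < K) :
    ∑ b ∈ Finset.range K, s7v c s j b * s7v c s k b = if j = k then 1 else 0 := by
  rcases lt_trichotomy j k with hjk | rfl | hjk
  · rw [s7_vv_lt c s hcs K j k hjk h, if_neg (by omega)]
  · have e : ∀ b, s7v c s j b * s7v c s j b =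
      c^2 * (s7u c s j b * s7u c s j b) + (2*c* s7u c s j b) * (if b = j+1 then s else 0)
       + s * (if b = j+1 then s else 0) := by
      intro b; simp only [s7v]; split_ifs <;> ring
    simp_rw [e]
    rw [Finset.sum_add_distrib, Finset.sum_add_distrib, ← Finset.mul_sum,
      s7_uu c s hcs K j (by omega),
      s7_sum_single K (j+1) h, s7_sum_single K (j+1) h (fun _ => s), s7u_zero c s j _ (by omega)]
    simp; nlinarith
  · simp_rw [mul_comm (s7v c s j _)]
    rw [s7_vv_lt c s hcs K k j hjk hj, if_neg (by omega)]

/-- the amplified isometry -/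
def s7T (c s : ℝ) (m n : ℕ) : ℝ :=
  if (Nat.unpair m).1 = (Nat.unpair n).1 then s7v c s (Nat.unpair n).2 (Nat.unpair m).2 else 0

/-- the complementary isometry -/
def s7W (m n : ℕ) : ℝ := if m = Nat.pair n 0 then 1 else 0

theorem s7_pair_lt {a b n : ℕ} (ha : a ≤ n) (hb : b ≤ n) : Nat.pair a b < (n+1)^2 :=
  lt_of_lt_of_le (Nat.pair_lt_max_add_one_sq a b)
    (Nat.pow_le_pow_left (by have := max_le ha hb; omega) 2)

theorem s7T_supp (c s : ℝ) : s7supp (s7T c s) := by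
  intro k i hi
  unfold s7T
  split_ifs with h
  · apply s7v_zero
    by_contra hc
    have h1 := s7_pair_lt (a := (Nat.unpair i).1) (b := (Nat.unpair i).2) (n := k+1)
      (by rw [h]; have := Nat.unpair_left_le k; omega)
      (by have := Nat.unpair_right_le k; omega)
    rw [Nat.pair_unpair] at h1
    have := Nat.pow_le_pow_left (show k+1+1 ≤ k+3 by omega) 2
    omega
  · rfl

theorem s7W_supp : s7supp s7W := by
  intro k i hi
  unfold s7W
  rw [if_neg]
  rintro rfl
  have h1 := s7_pair_lt (a := k) (b := 0) (n := k) le_rfl (by omega)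
  have := Nat.pow_le_pow_left (show k+1 ≤ k+3 by omega) 2
  omega

theorem s7_sum_pair (g : ℕ → ℝ) (i K m : ℕ) (hg : ∀ b, K ≤ b → g b = 0)
    (hm : ∀ b, b < K → Nat.pair i b < m) :
    ∑ p ∈ Finset.range m, (if (Nat.unpair p).1 = i then g (Nat.unpair p).2 else 0) =
      ∑ b ∈ Finset.range K, g b := by
  symm
  have hinj : Set.InjOn (Nat.pair i) (Finset.range K : Set ℕ) := by
    intro a _ b _ hab
    exact (Nat.pair_eq_pair.mp hab).2
  have e : ∑ b ∈ Finset.range K, g b = ∑ p ∈ (Finset.range K).image (Nat.pair i),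
      (if (Nat.unpair p).1 = i then g (Nat.unpair p).2 else 0) := by
    rw [Finset.sum_image hinj]
    simp
  rw [e]
  apply Finset.sum_subset
  · intro p hp
    simp only [Finset.mem_image, Finset.mem_range] at hp ⊢
    obtain ⟨b, hb, rfl⟩ := hp
    exact hm b hb
  · intro p _ hp
    split_ifs with h
    · apply hg
      by_contra hb
      apply hp
      simp only [Finset.mem_image, Finset.mem_range]
      exact ⟨_, not_le.mp hb, by rw [← h, Nat.pair_unpair]⟩
    · rfl

theorem s7T_Gr (c s : ℝ) (hcs : c^2 + s^2 = 1) : s7Gr 1 (s7T c s) (s7T c s) := by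
  intro n k l m hk hl hm
  have hk1 := Nat.unpair_left_le k
  have hk2 := Nat.unpair_right_le k
  have hl2 := Nat.unpair_right_le l
  by_cases h : (Nat.unpair k).1 = (Nat.unpair l).1
  · have e : ∀ p, s7T c s p k * s7T c s p l = if (Nat.unpair p).1 = (Nat.unpair k).1 then
        s7v c s (Nat.unpair k).2 (Nat.unpair p).2 * s7v c s (Nat.unpair l).2 (Nat.unpair p).2
        else 0 := by
      intro p
      simp only [s7T, ← h]
      split_ifs <;> simp
    simp_rw [e]
    rw [s7_sum_pair (fun b => s7v c s (Nat.unpair k).2 b * s7v c s (Nat.unpair l).2 b)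
      (Nat.unpair k).1 (n+1) m, s7_vv c s hcs]
    · congr 1
      apply propext
      constructor
      · intro h2
        rw [← Nat.pair_unpair k, ← Nat.pair_unpair l, h, h2]
      · rintro rfl; rfl
    · omega
    · omega
    · intro b hb
      beta_reduce
      rw [s7v_zero c s _ b (by omega), zero_mul]
    · intro b hb
      have := s7_pair_lt (a := (Nat.unpair k).1) (b := b) (n := n) (by omega) (by omega)
      nlinarith
  · rw [if_neg (by rintro rfl; exact h rfl)]
    apply Finset.sum_eq_zero
    intro p _
    unfold s7T
    split_ifs with h1 h2
    · exact absurd (h1.symm.trans h2) h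
    all_goals simp

theorem s7W_Gr : s7Gr 1 s7W s7W := by
  intro n k l m hk hl hm
  have h1 := s7_pair_lt (a := l) (b := 0) (n := n) (by omega) (by omega)
  simp only [s7W]
  rw [s7_sum_single m (Nat.pair l 0) (by nlinarith)]
  simp [eq_comm]

theorem s7TW_Gr : s7Gr 0 (s7T 0 1) s7W := by
  intro n k l m hk hl hm
  have h1 := s7_pair_lt (a := l) (b := 0) (n := n) (by omega) (by omega)
  simp only [s7W]
  rw [s7_sum_single m (Nat.pair l 0) (by nlinarith)]
  simp [s7T, s7v]

theorem s7Gr_symm {γ : ℝ} {V V' : ℕ → ℕ → ℝ} (h : s7Gr γ V V') : s7Gr γ V' V := by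
  intro n k l m hk hl hm
  simp_rw [mul_comm (V' _ _)]
  rw [h n l k m hl hk hm]
  simp [eq_comm]

theorem s7T_one (m n : ℕ) : s7T 1 0 m n = if m = n then 1 else 0 := by
  have hu : ∀ k i, s7u 1 0 k i = if i = k then 1 else 0 := by
    intro k i
    cases k <;> simp [s7u]
  simp only [s7T, s7v, hu]
  by_cases h : m = n
  · simp [h]
  · rw [if_neg h]
    by_cases h1 : (Nat.unpair m).1 = (Nat.unpair n).1
    · have h2 : (Nat.unpair m).2 ≠ (Nat.unpair n).2 := by
        intro h2
        apply h
        rw [← Nat.pair_unpair m, ← Nat.pair_unpair n, h1, h2]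
      simp [h1, h2]
    · simp [h1]

theorem s7T_cont (c s : unitInterval → ℝ) (hc : Continuous c) (hs : Continuous s) (m n : ℕ) :
    Continuous fun t => s7T (c t) (s t) m n := by
  have hu : ∀ k i, Continuous fun t => s7u (c t) (s t) k i := by
    intro k i
    induction k with
    | zero => simp only [s7u]; fun_prop
    | succ k ih =>
      simp only [s7u]
      split_ifs <;> fun_prop
  simp only [s7T, s7v]
  have := hu (Nat.unpair n).2 (Nat.unpair m).2
  split_ifs <;> fun_prop

end Rot

section Psi
open Matrix

variable {C KC : Type} [NonUnitalCStarAlgebra C] [NonUnitalCStarAlgebra KC]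

theorem s7_ind2 (St : Stabilization C KC) {p : KC → KC → Prop}
    (hp1 : ∀ y, IsClosed {x | p x y}) (hp2 : ∀ x, IsClosed {y | p x y})
    (h : ∀ n M M', p (St.j n M) (St.j n M')) (x y : KC) : p x y := by
  refine s7_ind St (p := fun x => p x y) (hp1 y) ?_ x
  intro n M
  refine s7_ind St (p := fun y => p (St.j n M) y) (hp2 _) ?_ y
  intro m M'
  rw [← s7J_raise St (le_max_left n m), ← s7J_raise St (le_max_right n m) M']
  exact h _ _ _

/-- `S` implements `M ↦ V M V'ᵀ`. -/
def s7Is (St : Stabilization C KC) (V V' : ℕ → ℕ → ℝ) (S : KC →L[ℂ] KC) : Prop :=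
  ∀ n (M : Matrix (Fin n) (Fin n) C) m, (n+2)^2 ≤ m → S (St.j n M) = s7J St m (s7cj V V' n M)

theorem s7Is_mul (St : Stabilization C KC) (γ : ℝ) {V V' V'' V''' : ℕ → ℕ → ℝ}
    (h : s7Gr γ V' V'') {S S' S'' : KC →L[ℂ] KC} (hS : s7Is St V V' S) (hS' : s7Is St V'' V''' S')
    (hS'' : s7Is St V V''' S'') (x y : KC) : S x * S' y = (γ : ℂ) • S'' (x * y) := by
  refine s7_ind2 St (p := fun x y => S x * S' y = (γ : ℂ) • S'' (x * y)) ?_ ?_ ?_ x y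
  · intro y; exact isClosed_eq (by fun_prop) (by fun_prop)
  · intro y; exact isClosed_eq (by fun_prop) (by fun_prop)
  · intro n M M'
    rw [← map_mul, hS n M _ le_rfl, hS' n M' _ le_rfl, hS'' n _ _ le_rfl, s7J_mul St γ h n _ le_rfl]

theorem s7Is_mul0 (St : Stabilization C KC) {V V' V'' V''' : ℕ → ℕ → ℝ}
    (h : s7Gr 0 V' V'') {S S' : KC →L[ℂ] KC} (hS : s7Is St V V' S) (hS' : s7Is St V'' V''' S')
    (x y : KC) : S x * S' y = 0 := by
  refine s7_ind2 St (p := fun x y => S x * S' y = 0) ?_ ?_ ?_ x y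
  · intro y; exact isClosed_eq (by fun_prop) (by fun_prop)
  · intro y; exact isClosed_eq (by fun_prop) (by fun_prop)
  · intro n M M'
    rw [hS n M _ le_rfl, hS' n M' _ le_rfl, s7J_mul St 0 h n _ le_rfl]
    simp

theorem s7Is_star (St : Stabilization C KC) {V V' : ℕ → ℕ → ℝ}
    {S S' : KC →L[ℂ] KC} (hS : s7Is St V V' S) (hS' : s7Is St V' V S')
    (x : KC) : star (S x) = S' (star x) := by
  refine s7_ind St (p := fun x => star (S x) = S' (star x)) ?_ ?_ x
  · exact isClosed_eq (by fun_prop) (by fun_prop)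
  · intro n M
    rw [← map_star (St.j n), hS n M _ le_rfl, hS' n _ _ le_rfl, s7J_star]

theorem s7_hom_ex (St : Stabilization C KC) {V : ℕ → ℕ → ℝ} (h : s7supp V) (g : s7Gr 1 V V) :
    ∃ H : KC →⋆ₙₐ[ℂ] KC, ∃ S : KC →L[ℂ] KC, s7Is St V V S ∧ ∀ x, H x = S x := by
  obtain ⟨S, hS⟩ := s7_S_ex St h h g g
  refine ⟨{ toFun := S, map_add' := map_add S, map_smul' := map_smul S, map_zero' := map_zero S,
            map_mul' := fun x y => ?_, map_star' := fun x => ?_ }, S, hS, fun _ => rfl⟩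
  · have := s7Is_mul St 1 g hS hS hS x y
    simpa using this.symm
  · exact (s7Is_star St hS hS x).symm

theorem s7_H_ex (St : Stabilization C KC) : ∃ H : unitInterval → (KC →⋆ₙₐ[ℂ] KC),
    (∀ x, Continuous fun t => H t x) ∧ (∀ x, H 0 x = x) ∧
    ∃ S : KC →L[ℂ] KC, s7Is St (s7T 0 1) (s7T 0 1) S ∧ ∀ x, H 1 x = S x := by
  let c : unitInterval → ℝ := fun t => Real.cos (Real.pi / 2 * t)
  let s : unitInterval → ℝ := fun t => Real.sin (Real.pi / 2 * t)
  have hcs : ∀ t, c t ^ 2 + s t ^ 2 = 1 := fun t => Real.cos_sq_add_sin_sq _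
  choose H S hS hH using fun t => s7_hom_ex St (s7T_supp (c t) (s t)) (s7T_Gr _ _ (hcs t))
  have hcont : ∀ n M, Continuous fun t => H t (St.j n M) := by
    intro n M
    have e : ∀ t, H t (St.j n M) = s7J St ((n+2)^2) (s7cj (s7T (c t) (s t)) (s7T (c t) (s t)) n M) := by
      intro t
      rw [hH, hS t n M _ le_rfl]
    simp_rw [e]
    unfold s7J
    refine (s7_mat_continuous (St.j ((n+2)^2))).comp ?_
    refine continuous_matrix fun i k => ?_
    simp only [of_apply, s7cj]
    refine continuous_finsetSum _ fun a _ => continuous_finsetSum _ fun b _ => ?_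
    have h1 := s7T_cont c s (by fun_prop) (by fun_prop) i a
    have h2 := s7T_cont c s (by fun_prop) (by fun_prop) k b
    exact (Complex.continuous_ofReal.comp (h1.mul h2)).smul continuous_const
  refine ⟨H, ?_, ?_, S 1, ?_, hH 1⟩
  · intro x
    refine continuous_of_uniform_approx_of_continuous fun u hu => ?_
    obtain ⟨ε, hε, hu⟩ := Metric.mem_uniformity_dist.mp hu
    have hx : x ∈ closure (⋃ n, Set.range (St.j n)) := by rw [St.dense]; trivial
    obtain ⟨y, hy, hxy⟩ := Metric.mem_closure_iff.mp hx ε hε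
    obtain ⟨_, ⟨n, rfl⟩, M, rfl⟩ := hy
    refine ⟨fun t => H t (St.j n M), hcont n M, fun t => hu ?_⟩
    rw [dist_eq_norm, ← map_sub]
    rw [dist_eq_norm] at hxy
    exact lt_of_le_of_lt (NonUnitalStarAlgHom.norm_apply_le (H t) _) hxy
  · intro x
    refine s7_ind St (p := fun x => H 0 x = x) ?_ ?_ x
    · exact isClosed_eq (s7_continuous _) continuous_id
    · intro n M
      rw [hH, hS 0 n M _ le_rfl]
      have e : s7cj (s7T (c 0) (s 0)) (s7T (c 0) (s 0)) n M = s7ext M := by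
        have hc : c 0 = 1 := by simp [c]
        have hs : s 0 = 0 := by simp [s]
        rw [hc, hs]
        funext i i'
        simp only [s7cj, s7T_one, s7ext]
        split_ifs with h
        · rw [Finset.sum_eq_single ⟨i, h.1⟩, Finset.sum_eq_single ⟨i', h.2⟩]
          · simp
          · intro b _ hb
            have : i' ≠ b := fun h => hb (Fin.ext h.symm)
            simp [this]
          · simp
          · intro b _ hb
            have : i ≠ b := fun h => hb (Fin.ext h.symm)
            simp [this]
          · simp
        · refine Finset.sum_eq_zero fun a _ => Finset.sum_eq_zero fun b _ => ?_
          by_cases h1 : i = a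
          · have : i' ≠ b := by
              intro h2; exact h ⟨h1 ▸ a.2, h2 ▸ b.2⟩
            simp [this]
          · simp [h1]
      rw [e]
      exact s7J_raise St (by nlinarith) M
  · have hc : c 1 = 0 := by simp [c]
    have hs : s 1 = 1 := by simp [s]
    have := hS 1
    rwa [hc, hs] at this

/-- padding -/
def s7pad {X : Type} [Zero X] (M : Matrix (Fin 2) (Fin 2) X) : Matrix (Fin 3) (Fin 3) X :=
  Matrix.of ![![M 0 0, M 0 1, 0], ![M 1 0, M 1 1, 0], ![0, 0, 0]]

set_option maxHeartbeats 1000000 in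
theorem s7_stab (St : Stabilization C KC) :
    ∃ Ψ : Matrix (Fin 3) (Fin 3) KC →⋆ₙₐ[ℂ] Matrix (Fin 2) (Fin 2) KC, Continuous Ψ ∧
    ∃ H : unitInterval → (KC →⋆ₙₐ[ℂ] KC), (∀ x, Continuous fun t => H t x) ∧ (∀ x, H 0 x = x) ∧
    ∀ X, Ψ (s7pad X) = matMap₂ (H 1) X := by
  obtain ⟨H, h1, h2, S0, hS0, h3⟩ := s7_H_ex St
  have gT := s7T_Gr 0 1 (by norm_num)
  have gW := s7W_Gr
  have gTW := s7TW_Gr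
  have gWT := s7Gr_symm s7TW_Gr
  obtain ⟨S1, hS1⟩ := s7_S_ex St (s7T_supp 0 1) s7W_supp gT gW
  obtain ⟨S2, hS2⟩ := s7_S_ex St s7W_supp (s7T_supp 0 1) gW gT
  obtain ⟨S3, hS3⟩ := s7_S_ex St s7W_supp s7W_supp gW gW
  have o : ∀ z : KC, ((1 : ℝ) : ℂ) • z = z := fun z => by simp
  have m00 : ∀ x y, S0 x * S0 y = S0 (x * y) := fun x y => (s7Is_mul St 1 gT hS0 hS0 hS0 x y).trans (o _)
  have m01 : ∀ x y, S0 x * S1 y = S1 (x * y) := fun x y => (s7Is_mul St 1 gT hS0 hS1 hS1 x y).trans (o _)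
  have m02 : ∀ x y, S0 x * S2 y = 0 := fun x y => s7Is_mul0 St gTW hS0 hS2 x y
  have m03 : ∀ x y, S0 x * S3 y = 0 := fun x y => s7Is_mul0 St gTW hS0 hS3 x y
  have m10 : ∀ x y, S1 x * S0 y = 0 := fun x y => s7Is_mul0 St gWT hS1 hS0 x y
  have m11 : ∀ x y, S1 x * S1 y = 0 := fun x y => s7Is_mul0 St gWT hS1 hS1 x y
  have m12 : ∀ x y, S1 x * S2 y = S0 (x * y) := fun x y => (s7Is_mul St 1 gW hS1 hS2 hS0 x y).trans (o _)
  have m13 : ∀ x y, S1 x * S3 y = S1 (x * y) := fun x y => (s7Is_mul St 1 gW hS1 hS3 hS1 x y).trans (o _)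
  have m20 : ∀ x y, S2 x * S0 y = S2 (x * y) := fun x y => (s7Is_mul St 1 gT hS2 hS0 hS2 x y).trans (o _)
  have m21 : ∀ x y, S2 x * S1 y = S3 (x * y) := fun x y => (s7Is_mul St 1 gT hS2 hS1 hS3 x y).trans (o _)
  have m22 : ∀ x y, S2 x * S2 y = 0 := fun x y => s7Is_mul0 St gTW hS2 hS2 x y
  have m23 : ∀ x y, S2 x * S3 y = 0 := fun x y => s7Is_mul0 St gTW hS2 hS3 x y
  have m30 : ∀ x y, S3 x * S0 y = 0 := fun x y => s7Is_mul0 St gWT hS3 hS0 x y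
  have m31 : ∀ x y, S3 x * S1 y = 0 := fun x y => s7Is_mul0 St gWT hS3 hS1 x y
  have m32 : ∀ x y, S3 x * S2 y = S2 (x * y) := fun x y => (s7Is_mul St 1 gW hS3 hS2 hS2 x y).trans (o _)
  have m33 : ∀ x y, S3 x * S3 y = S3 (x * y) := fun x y => (s7Is_mul St 1 gW hS3 hS3 hS3 x y).trans (o _)
  have t0 := s7Is_star St hS0 hS0
  have t1 := s7Is_star St hS1 hS2
  have t2 := s7Is_star St hS2 hS1
  have t3 := s7Is_star St hS3 hS3
  obtain ⟨Ψ, hΨ⟩ : ∃ Ψ : Matrix (Fin 3) (Fin 3) KC →⋆ₙₐ[ℂ] Matrix (Fin 2) (Fin 2) KC,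
      ∀ X, Ψ X = Matrix.of ![![S0 (X 0 0) + S1 (X 0 2) + S2 (X 2 0) + S3 (X 2 2),
          S0 (X 0 1) + S2 (X 2 1)], ![S0 (X 1 0) + S1 (X 1 2), S0 (X 1 1)]] := by
   refine ⟨
    { toFun := fun X => Matrix.of ![![S0 (X 0 0) + S1 (X 0 2) + S2 (X 2 0) + S3 (X 2 2),
          S0 (X 0 1) + S2 (X 2 1)], ![S0 (X 1 0) + S1 (X 1 2), S0 (X 1 1)]]
      map_add' := fun X Y => by
        ext i k; fin_cases i <;> fin_cases k <;> simp <;> abel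
      map_smul' := fun a X => by
        ext i k; fin_cases i <;> fin_cases k <;> simp [smul_add]
      map_zero' := by
        ext i k; fin_cases i <;> fin_cases k <;> simp
      map_mul' := fun X Y => by
        ext i k; fin_cases i <;> fin_cases k <;>
          simp [Matrix.mul_apply, Fin.sum_univ_three, Fin.sum_univ_two, add_mul, mul_add, m00, m01, m02, m03,
            m10, m11, m12, m13, m20, m21, m22, m23, m30, m31, m32, m33] <;> abel
      map_star' := fun X => by
        ext i k; fin_cases i <;> fin_cases k <;>
          simp [Matrix.star_apply, t0, t1, t2, t3] <;> abel }, fun _ => rfl⟩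
  refine ⟨Ψ, ?_, H, h1, h2, ?_⟩
  · have hc : ∀ a b, Continuous fun X : Matrix (Fin 3) (Fin 3) KC => X a b :=
      fun a b => continuous_id.matrix_elem a b
    refine continuous_matrix fun i k => ?_
    simp_rw [hΨ]
    fin_cases i <;> fin_cases k <;> simp <;> fun_prop
  · intro X
    rw [hΨ]
    change Matrix.of _ = X.map _
    ext i k
    fin_cases i <;> fin_cases k <;> simp [s7pad, h3]

end Psi

section EA
open Filter Topology

theorem s7_approx_mem {X Y : Type} [NonUnitalCStarAlgebra X] [NonUnitalCStarAlgebra Y]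
    (α : X →⋆ₙₐ[ℂ] Y) (z : X) :
    α z ∈ closure ((Submodule.span ℂ
      {x : Y | ∃ z w : X, ∃ b : Y, x = α z * b * α w} : Submodule ℂ Y) : Set Y) := by
  let _ : PartialOrder X := CStarAlgebra.spectralOrder X
  have _ : StarOrderedRing X := CStarAlgebra.spectralOrderedRing X
  have hu := CStarAlgebra.increasingApproximateUnit X
  have hα := s7_continuous α
  refine isClosed_closure.mem_of_tendsto ((hα.tendsto z).comp (hu.tendsto_mul_left z))
    (Eventually.of_forall fun e => ?_)
  refine isClosed_closure.mem_of_tendsto ((hα.tendsto _).comp (hu.tendsto_mul_right (z * e)))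
    (Eventually.of_forall fun e' => ?_)
  apply subset_closure
  apply Submodule.subset_span
  exact ⟨e', e, α z, by simp [mul_assoc]⟩

theorem s7_coe_mul {B : Type} [NonUnitalCStarAlgebra B] (b : B) (T : 𝓜(ℂ, B)) :
    (b : 𝓜(ℂ, B)) * T = ((T.snd b : B) : 𝓜(ℂ, B)) := by
  apply DoubleCentralizer.ext
  apply Prod.ext
  · ext x
    change b * T.fst x = T.snd b * x
    exact (T.central b x).symm
  · ext x
    change T.snd (x * b) = x * T.snd b
    have h : ∀ y : B, (T.snd (x * b) - x * T.snd b) * y = 0 := by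
      intro y
      rw [sub_mul, mul_assoc, T.central, T.central, mul_assoc, sub_self]
    have := h (star (T.snd (x * b) - x * T.snd b))
    rw [CStarRing.mul_star_self_eq_zero_iff] at this
    exact sub_eq_zero.mp this

theorem s7_mul_coe {B : Type} [NonUnitalCStarAlgebra B] (b : B) (T : 𝓜(ℂ, B)) :
    T * (b : 𝓜(ℂ, B)) = ((T.fst b : B) : 𝓜(ℂ, B)) := by
  have hs : ∀ c : B, star (c : 𝓜(ℂ, B)) = ((star c : B) : 𝓜(ℂ, B)) := fun c =>
    (map_star (DoubleCentralizer.coeHom (𝕜 := ℂ) (A := B)) c).symm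
  have h := congrArg star (s7_coe_mul (star b) (star T))
  rw [star_mul, star_star, hs, hs] at h
  simpa using h

theorem s7_coe_inj {B : Type} [NonUnitalCStarAlgebra B] :
    Function.Injective (DoubleCentralizer.coeHom (𝕜 := ℂ) (A := B)) := by
  rw [injective_iff_map_eq_zero]
  intro b hb
  have h : (b : 𝓜(ℂ, B)).fst (star b) = 0 := by
    change ((DoubleCentralizer.coeHom (𝕜 := ℂ) (A := B)) b).fst (star b) = 0
    rw [hb]; rfl
  exact (CStarRing.mul_star_self_eq_zero_iff b).mp h

theorem s7_EA {A QA qA : Type}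
    [NonUnitalCStarAlgebra A] [NonUnitalCStarAlgebra QA] [NonUnitalCStarAlgebra qA]
    {P₁ : QPresentation A QA} {j₁ : qA →⋆ₙₐ[ℂ] QA} {KB : Type} [NonUnitalCStarAlgebra KB]
    {α : qA →⋆ₙₐ[ℂ] KB} {B₀T EαT : Type} [NonUnitalCStarAlgebra B₀T] [NonUnitalCStarAlgebra EαT]
    (D : EalphaData A QA qA P₁ j₁ KB α B₀T EαT) (π₁ : QA →⋆ₙₐ[ℂ] A)
    (hπ₁ : ∀ x, π₁ (P₁.ι x) = x) (hπ₁' : ∀ x, π₁ (P₁.ιbar x) = x)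
    (hr₁ : Set.range j₁ = {z : QA | π₁ z = 0}) :
    ∃ p : EαT →⋆ₙₐ[ℂ] A, (∀ x, p (D.αE x) = x) ∧ (∀ x, p (D.αbarE x) = x) ∧
      (∀ b, p (D.jEB b) = 0) ∧ (∀ e, p e = 0 → ∃ b, D.jEB b = e) ∧ Function.Injective D.jEB ∧
      (∀ F : QA →⋆ₙₐ[ℂ] EαT, (∀ x, F (P₁.ι x) = D.αE x) → (∀ x, F (P₁.ιbar x) = D.αbarE x) →
        ∀ z, ∃ u, D.jB₀ u = α z ∧ D.jEB u = F (j₁ z)) := by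
  have hu : ∀ z, ∃ u, D.jB₀ u = α z := by
    intro z
    have := s7_approx_mem α z
    rw [← D.hjB₀r] at this
    exact this
  have hπj : ∀ z, π₁ (j₁ z) = 0 := by
    intro z
    have : j₁ z ∈ Set.range j₁ := ⟨z, rfl⟩
    rwa [hr₁] at this
  have hcl : IsClosed (Set.range (DoubleCentralizer.coeHom (𝕜 := ℂ) (A := B₀T))) :=
    (NonUnitalStarAlgHom.isometry _ s7_coe_inj).isClosedEmbedding.isClosed_range
  let N : NonUnitalStarSubalgebra ℂ (𝓜(ℂ, B₀T) × A) :=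
    { carrier := {m | m.1 - D.αext (P₁.ι m.2) ∈
        Set.range (DoubleCentralizer.coeHom (𝕜 := ℂ) (A := B₀T))}
      add_mem' := by
        rintro m n ⟨b, hb⟩ ⟨c, hc⟩
        refine ⟨b + c, ?_⟩
        rw [map_add, hb, hc, Prod.fst_add, Prod.snd_add, map_add, map_add]
        abel
      zero_mem' := ⟨0, by rw [map_zero, Prod.fst_zero, Prod.snd_zero, map_zero, map_zero, sub_zero]⟩
      smul_mem' := by
        rintro a m ⟨b, hb⟩
        refine ⟨a • b, ?_⟩
        rw [map_smul, hb, Prod.smul_fst, Prod.smul_snd, map_smul, map_smul, smul_sub]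
      mul_mem' := by
        rintro m n ⟨b, hb⟩ ⟨c, hc⟩
        refine ⟨n.1.snd b + (D.αext (P₁.ι m.2)).fst c, ?_⟩
        have h1 := s7_coe_mul b n.1
        have h2 := s7_mul_coe c (D.αext (P₁.ι m.2))
        change DoubleCentralizer.coeHom _ * _ = DoubleCentralizer.coeHom _ at h1
        change _ * DoubleCentralizer.coeHom _ = DoubleCentralizer.coeHom _ at h2
        rw [map_add, ← h1, ← h2, hb, hc, Prod.fst_mul, Prod.snd_mul, map_mul, map_mul]
        noncomm_ring
      star_mem' := by
        rintro m ⟨b, hb⟩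
        refine ⟨star b, ?_⟩
        rw [map_star, hb, Prod.fst_star, Prod.snd_star, map_star, map_star, star_sub] }
  have hN : IsClosed (N : Set (𝓜(ℂ, B₀T) × A)) := by
    have hc : Continuous fun m : 𝓜(ℂ, B₀T) × A => m.1 - D.αext (P₁.ι m.2) :=
      continuous_fst.sub ((s7_continuous D.αext).comp ((s7_continuous P₁.ι).comp continuous_snd))
    exact hcl.preimage hc
  have hle : ∀ e, D.jE e ∈ N := by
    intro e
    have he : D.jE e ∈ Set.range D.jE := ⟨e, rfl⟩
    rw [D.hjEr] at he
    refine NonUnitalStarSubalgebra.topologicalClosure_minimal _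
      (NonUnitalStarAlgebra.adjoin_le ?_) hN he
    rintro _ ((⟨b, rfl⟩ | ⟨x, rfl⟩) | ⟨x, rfl⟩)
    · refine ⟨b, ?_⟩
      simp only [map_zero, sub_zero]; rfl
    · refine ⟨0, ?_⟩
      simp only [map_zero, sub_self]
    · have hk : P₁.ιbar x - P₁.ι x ∈ Set.range j₁ := by
        rw [hr₁]; simp [hπ₁, hπ₁']
      obtain ⟨z, hz⟩ := hk
      obtain ⟨u, hu⟩ := hu z
      refine ⟨u, ?_⟩
      change (u : 𝓜(ℂ, B₀T)) = D.αext (P₁.ιbar x) - D.αext (P₁.ι x)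
      rw [← map_sub, ← hz, D.hαext z u hu]
  refine ⟨(NonUnitalStarAlgHom.snd ℂ 𝓜(ℂ, B₀T) A).comp D.jE, ?_, ?_, ?_, ?_, ?_, ?_⟩
  · intro x
    change (D.jE (D.αE x)).2 = x
    rw [D.hαE]
  · intro x
    change (D.jE (D.αbarE x)).2 = x
    rw [D.hαbarE]
  · intro x
    change (D.jE (D.jEB x)).2 = 0
    rw [D.hjEB]
  · intro e he
    change (D.jE e).2 = 0 at he
    obtain ⟨b, hb⟩ := hle e
    refine ⟨b, D.hjEinj ?_⟩
    rw [D.hjEB]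
    apply Prod.ext
    · rw [he, map_zero, map_zero, sub_zero] at hb
      exact hb
    · exact he.symm
  · intro b c h
    apply s7_coe_inj
    have := congrArg (fun e => (D.jE e).1) h
    simp only [D.hjEB] at this
    exact this
  · intro F h1 h2 z
    obtain ⟨u, hu⟩ := hu z
    refine ⟨u, hu, D.hjEinj ?_⟩
    have e : D.jE.comp F = D.αext.prod π₁ := by
      apply s7_free_ext P₁
      · intro x
        change D.jE (F _) = (D.αext _, π₁ _)
        rw [h1, D.hαE, hπ₁]
      · intro x
        change D.jE (F _) = (D.αext _, π₁ _)
        rw [h2, D.hαbarE, hπ₁']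
    have e2 : D.jE (F (j₁ z)) = (D.αext (j₁ z), π₁ (j₁ z)) := DFunLike.congr_fun e (j₁ z)
    rw [e2, D.hjEB, hπj, D.hαext z u hu]

end EA

section Pair
open Matrix

/-- entrywise application -/
def s7map {X Y : Type} [NonUnitalCStarAlgebra X] [NonUnitalCStarAlgebra Y] (f : X →⋆ₙₐ[ℂ] Y) :
    Matrix (Fin 3) (Fin 3) X →⋆ₙₐ[ℂ] Matrix (Fin 3) (Fin 3) Y where
  toFun M := M.map f
  map_add' x y := by ext i k; simp [Matrix.map_apply]
  map_smul' c x := by ext i k; simp [Matrix.map_apply]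
  map_zero' := by ext i k; simp [Matrix.map_apply]
  map_mul' x y := by
    ext i k
    simp [Matrix.map_apply, Matrix.mul_apply]
  map_star' x := by
    ext i k
    simp [Matrix.map_apply, Matrix.star_apply, map_star]

/-- evaluation -/
def s7ev {E : Type} [NonUnitalCStarAlgebra E] (t : unitInterval) : C(unitInterval, E) →⋆ₙₐ[ℂ] E where
  toFun f := f t
  map_add' _ _ := rfl
  map_smul' _ _ := rfl
  map_zero' := rfl
  map_mul' _ _ := rfl
  map_star' _ := rfl

/-- diagonal homomorphisms -/
def s7D {X Y : Type} [NonUnitalCStarAlgebra X] [NonUnitalCStarAlgebra Y] (f g h : X →⋆ₙₐ[ℂ] Y) :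
    X →⋆ₙₐ[ℂ] Matrix (Fin 3) (Fin 3) Y where
  toFun x := Matrix.diagonal ![f x, g x, h x]
  map_add' x y := by ext i k; fin_cases i <;> fin_cases k <;> simp
  map_smul' c x := by ext i k; fin_cases i <;> fin_cases k <;> simp
  map_zero' := by ext i k; fin_cases i <;> fin_cases k <;> simp
  map_mul' x y := by
    ext i k; fin_cases i <;> fin_cases k <;> simp [Matrix.mul_apply, Fin.sum_univ_three]
  map_star' x := by
    ext i k; fin_cases i <;> fin_cases k <;> simp [Matrix.star_apply, map_star]

theorem s7_rot {A E : Type} [NonUnitalCStarAlgebra A] [NonUnitalCStarAlgebra E]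
    (g : Fin 3 → (A →⋆ₙₐ[ℂ] E)) (R : unitInterval → Matrix (Fin 3) (Fin 3) ℝ) (hR : Continuous R)
    (hO : ∀ t, (R t)ᵀ * R t = 1) :
    ∃ G : A →⋆ₙₐ[ℂ] Matrix (Fin 3) (Fin 3) C(unitInterval, E), ∀ x i k t,
      G x i k t = ∑ l, ((R t i l * R t k l : ℝ) : ℂ) • g l x := by
  have hRc : ∀ i l, Continuous fun t => R t i l := fun i l => hR.matrix_elem i l
  let G0 : A → Matrix (Fin 3) (Fin 3) C(unitInterval, E) := fun x => Matrix.of fun i k =>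
    ⟨fun t => ∑ l, ((R t i l * R t k l : ℝ) : ℂ) • g l x, by
      refine continuous_finsetSum _ fun l _ => ?_
      exact (Complex.continuous_ofReal.comp ((hRc i l).mul (hRc k l))).smul continuous_const⟩
  have hG0 : ∀ x i k t, G0 x i k t = ∑ l, ((R t i l * R t k l : ℝ) : ℂ) • g l x :=
    fun _ _ _ _ => rfl
  refine ⟨{ toFun := G0
            map_add' := ?_
            map_smul' := ?_
            map_zero' := ?_
            map_mul' := ?_
            map_star' := ?_ }, hG0⟩
  · intro a x
    ext i k t
    rw [hG0]
    change _ = a • (G0 x i k t)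
    rw [hG0, Finset.smul_sum]
    refine Finset.sum_congr rfl fun l _ => ?_
    rw [map_smul, smul_comm]
  · ext i k t
    change G0 0 i k t = 0
    rw [hG0]; simp
  · intro x y
    ext i k t
    rw [hG0]
    change _ = G0 x i k t + G0 y i k t
    rw [hG0, hG0, ← Finset.sum_add_distrib]
    simp
  · intro x y
    ext i k t
    rw [hG0, Matrix.mul_apply, ContinuousMap.sum_apply]
    have e : ∀ m, (G0 x i m * G0 y m k) t = ∑ l, ∑ l',
        (((R t i l * R t k l' : ℝ) : ℂ) * ((R t m l * R t m l' : ℝ) : ℂ)) • (g l x * g l' y) := by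
      intro m
      change G0 x i m t * G0 y m k t = _
      rw [hG0, hG0, Finset.sum_mul]
      refine Finset.sum_congr rfl fun l _ => ?_
      rw [Finset.mul_sum]
      refine Finset.sum_congr rfl fun l' _ => ?_
      rw [smul_mul_smul_comm]
      congr 1
      push_cast; ring
    simp_rw [e]
    rw [Finset.sum_comm]
    refine Finset.sum_congr rfl fun l _ => ?_
    rw [Finset.sum_comm]
    simp_rw [← Finset.sum_smul, ← Finset.mul_sum]
    have e2 : ∀ l', (∑ m, ((R t m l * R t m l' : ℝ) : ℂ)) = if l = l' then 1 else 0 := by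
      intro l'
      have := congrFun (congrFun (hO t) l) l'
      rw [Matrix.mul_apply, Matrix.one_apply] at this
      simp only [Matrix.transpose_apply] at this
      rw [← Complex.ofReal_sum, this]
      split_ifs <;> simp
    simp_rw [e2]
    simp [map_mul]
  · intro x
    ext i k t
    rw [hG0, Matrix.star_apply]
    change _ = star (G0 x k i t)
    rw [hG0, star_sum]
    refine Finset.sum_congr rfl fun l _ => ?_
    rw [map_star, star_smul]
    congr 1
    simp [mul_comm]

theorem s7_stage {A QA qA QqA q2A : Type}
    [NonUnitalCStarAlgebra A] [NonUnitalCStarAlgebra QA] [NonUnitalCStarAlgebra qA]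
    [NonUnitalCStarAlgebra QqA] [NonUnitalCStarAlgebra q2A]
    (P₁ : QPresentation A QA) (j₁ : qA →⋆ₙₐ[ℂ] QA)
    (P₂ : QPresentation qA QqA) (π₂ : QqA →⋆ₙₐ[ℂ] qA)
    (hπ₂ : ∀ z, π₂ (P₂.ι z) = z) (hπ₂' : ∀ z, π₂ (P₂.ιbar z) = z)
    (j₂ : q2A →⋆ₙₐ[ℂ] QqA) (hr₂ : Set.range j₂ = {v : QqA | π₂ v = 0})
    {C₀ E E' KC : Type} [NonUnitalCStarAlgebra C₀] [NonUnitalCStarAlgebra E]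
    [NonUnitalCStarAlgebra E'] [NonUnitalCStarAlgebra KC]
    (p : E →⋆ₙₐ[ℂ] E') (jEB : C₀ →⋆ₙₐ[ℂ] E) (hinj : Function.Injective jEB)
    (hker : ∀ e, p e = 0 → ∃ b, jEB b = e) (jB₀ : C₀ →⋆ₙₐ[ℂ] KC)
    (f fb g gb : A →⋆ₙₐ[ℂ] Matrix (Fin 3) (Fin 3) C(unitInterval, E))
    (hfg : ∀ x i k t, p (f x i k t) = p (g x i k t))
    (hfgb : ∀ x i k t, p (fb x i k t) = p (gb x i k t)) :
    ∃ T : unitInterval → (q2A →⋆ₙₐ[ℂ] Matrix (Fin 3) (Fin 3) KC),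
      (∀ w, Continuous fun t => T t w) ∧
      ∀ t (F G : QA →⋆ₙₐ[ℂ] Matrix (Fin 3) (Fin 3) E) (h : QqA →⋆ₙₐ[ℂ] Matrix (Fin 3) (Fin 3) E),
        (∀ x i k, F (P₁.ι x) i k = f x i k t) → (∀ x i k, F (P₁.ιbar x) i k = fb x i k t) →
        (∀ x i k, G (P₁.ι x) i k = g x i k t) → (∀ x i k, G (P₁.ιbar x) i k = gb x i k t) →
        (∀ z, h (P₂.ι z) = F (j₁ z)) → (∀ z, h (P₂.ιbar z) = G (j₁ z)) →
        ∀ w i k, ∃ c, jEB c = h (j₂ w) i k ∧ jB₀ c = T t w i k := by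
  obtain ⟨F, hF, hFb⟩ := s7_free_ex_mat P₁ f fb
  obtain ⟨G, hG, hGb⟩ := s7_free_ex_mat P₁ g gb
  obtain ⟨h, hh, hhb⟩ := s7_free_ex_mat P₂ (F.comp j₁) (G.comp j₁)
  have hFG : ∀ t, (s7map (p.comp (s7ev t))).comp F = (s7map (p.comp (s7ev t))).comp G := by
    intro t
    apply s7_free_ext_mat P₁
    · intro x
      ext i k
      change p (F (P₁.ι x) i k t) = p (G (P₁.ι x) i k t)
      rw [hF, hG, hfg]
    · intro x
      ext i k
      change p (F (P₁.ιbar x) i k t) = p (G (P₁.ιbar x) i k t)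
      rw [hFb, hGb, hfgb]
  have hp : ∀ t w i k, p (h (j₂ w) i k t) = 0 := by
    intro t w i k
    have e : (s7map (p.comp (s7ev t))).comp h =
        ((s7map (p.comp (s7ev t))).comp (F.comp j₁)).comp π₂ := by
      apply s7_free_ext_mat P₂
      · intro z
        simp only [NonUnitalStarAlgHom.comp_apply]
        rw [hh, hπ₂, NonUnitalStarAlgHom.comp_apply]
      · intro z
        simp only [NonUnitalStarAlgHom.comp_apply]
        rw [hhb, hπ₂', NonUnitalStarAlgHom.comp_apply]
        exact (DFunLike.congr_fun (hFG t) (j₁ z)).symm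
    have hz : π₂ (j₂ w) = 0 := by
      have : j₂ w ∈ Set.range j₂ := ⟨w, rfl⟩
      rwa [hr₂] at this
    have e2 := DFunLike.congr_fun e (j₂ w)
    rw [NonUnitalStarAlgHom.comp_apply, NonUnitalStarAlgHom.comp_apply _ π₂, hz, map_zero] at e2
    exact congrFun (congrFun e2 i) k
  choose c hc using fun t w i k => hker _ (hp t w i k)
  let T : unitInterval → (q2A →⋆ₙₐ[ℂ] Matrix (Fin 3) (Fin 3) KC) := fun t =>
    { toFun := fun w => Matrix.of fun i k => jB₀ (c t w i k)
      map_add' := fun w w' => by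
        ext i k
        change jB₀ _ = jB₀ _ + jB₀ _
        rw [← map_add]
        congr 1
        apply hinj
        rw [map_add, hc, hc, hc, map_add, map_add]; rfl
      map_smul' := fun a w => by
        ext i k
        change jB₀ _ = a • jB₀ _
        rw [← map_smul]
        congr 1
        apply hinj
        rw [map_smul, hc, hc, map_smul, map_smul]; rfl
      map_zero' := by
        ext i k
        change jB₀ _ = 0
        rw [← map_zero jB₀]
        congr 1
        apply hinj
        rw [hc, map_zero, map_zero, map_zero]; rfl
      map_mul' := fun w w' => by
        ext i k
        rw [Matrix.mul_apply]
        change jB₀ _ = ∑ m, jB₀ _ * jB₀ _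
        simp_rw [← map_mul]
        rw [← map_sum]
        congr 1
        apply hinj
        rw [map_sum, hc, map_mul, map_mul, Matrix.mul_apply, ContinuousMap.sum_apply]
        refine Finset.sum_congr rfl fun m _ => ?_
        rw [map_mul, hc, hc]; rfl
      map_star' := fun w => by
        ext i k
        rw [Matrix.star_apply]
        change jB₀ _ = star (jB₀ _)
        rw [← map_star]
        congr 1
        apply hinj
        rw [map_star, hc, hc, map_star, map_star, Matrix.star_apply]; rfl }
  refine ⟨T, ?_, ?_⟩
  · intro w
    refine continuous_matrix fun i k => ?_
    change Continuous fun t => jB₀ (c t w i k)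
    refine (s7_continuous jB₀).comp ?_
    rw [(NonUnitalStarAlgHom.isometry jEB hinj).isEmbedding.continuous_iff]
    have : (jEB ∘ fun t => c t w i k) = fun t => h (j₂ w) i k t := by
      funext t; exact hc t w i k
    rw [this]
    exact (h (j₂ w) i k).continuous
  · intro t F' G' h' h1 h2 h3 h4 h5 h6 w i k
    have eF : (s7map (s7ev t)).comp F = F' := by
      apply s7_free_ext_mat P₁
      · intro x; ext i k
        change F (P₁.ι x) i k t = _
        rw [hF, h1]
      · intro x; ext i k
        change F (P₁.ιbar x) i k t = _
        rw [hFb, h2]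
    have eG : (s7map (s7ev t)).comp G = G' := by
      apply s7_free_ext_mat P₁
      · intro x; ext i k
        change G (P₁.ι x) i k t = _
        rw [hG, h3]
      · intro x; ext i k
        change G (P₁.ιbar x) i k t = _
        rw [hGb, h4]
    have eh : (s7map (s7ev t)).comp h = h' := by
      apply s7_free_ext_mat P₂
      · intro z
        rw [NonUnitalStarAlgHom.comp_apply]
        rw [hh, h5, ← eF]; rfl
      · intro z
        rw [NonUnitalStarAlgHom.comp_apply]
        rw [hhb, h6, ← eG]; rfl
    refine ⟨c t w i k, ?_, rfl⟩
    rw [hc, ← eh]; rfl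

end Pair

section Main
open Matrix

variable {A E E' : Type} [NonUnitalCStarAlgebra A] [NonUnitalCStarAlgebra E]
  [NonUnitalCStarAlgebra E']

theorem s7_const (g0 g1 g2 : A →⋆ₙₐ[ℂ] E) :
    ∃ G : A →⋆ₙₐ[ℂ] Matrix (Fin 3) (Fin 3) C(unitInterval, E), ∀ x i k t,
      G x i k t = s7D g0 g1 g2 x i k := by
  obtain ⟨G, hG⟩ := s7_rot ![g0, g1, g2] (fun _ => 1) continuous_const (by simp)
  refine ⟨G, fun x i k t => ?_⟩
  rw [hG]
  change _ = Matrix.diagonal ![g0 x, g1 x, g2 x] i k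
  fin_cases i <;> fin_cases k <;> simp [Fin.sum_univ_three, Matrix.one_apply]

/-- cosine path -/
def s7c (t : unitInterval) : ℝ := Real.cos (Real.pi / 2 * t)
/-- sine path -/
def s7s (t : unitInterval) : ℝ := Real.sin (Real.pi / 2 * t)

theorem s7c_cont : Continuous s7c := by unfold s7c; fun_prop
theorem s7s_cont : Continuous s7s := by unfold s7s; fun_prop
theorem s7cs (t : unitInterval) : s7c t * s7c t + s7s t * s7s t = 1 := by
  have := Real.cos_sq_add_sin_sq (Real.pi / 2 * t)
  rw [sq, sq] at this
  exact this
theorem s7c0 : s7c 0 = 1 := by simp [s7c]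
theorem s7c1 : s7c 1 = 0 := by simp [s7c]
theorem s7s0 : s7s 0 = 0 := by simp [s7s]
theorem s7s1 : s7s 1 = 1 := by simp [s7s]

theorem s7_rot12 (g0 g1 g2 : A →⋆ₙₐ[ℂ] E) (p : E →⋆ₙₐ[ℂ] E') (hp : ∀ x, p (g1 x) = p (g2 x)) :
    ∃ G : A →⋆ₙₐ[ℂ] Matrix (Fin 3) (Fin 3) C(unitInterval, E),
      (∀ x i k, G x i k 0 = s7D g0 g1 g2 x i k) ∧ (∀ x i k, G x i k 1 = s7D g0 g2 g1 x i k) ∧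
      ∀ x i k t, p (G x i k t) = p (s7D g0 g1 g2 x i k) := by
  obtain ⟨G, hG⟩ := s7_rot ![g0, g1, g2]
    (fun t => Matrix.of ![![1, 0, 0], ![0, s7c t, s7s t], ![0, -s7s t, s7c t]])
    (by
      have := s7c_cont
      have := s7s_cont
      refine continuous_matrix fun i k => ?_
      fin_cases i <;> fin_cases k <;> simp <;> fun_prop)
    (by
      intro t
      have := s7cs t
      ext i k
      fin_cases i <;> fin_cases k <;>
        simp [Matrix.mul_apply, Fin.sum_univ_three, Matrix.one_apply] <;> linarith)
  refine ⟨G, fun x i k => ?_, fun x i k => ?_, fun x i k t => ?_⟩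
  · rw [hG]
    change _ = Matrix.diagonal ![g0 x, g1 x, g2 x] i k
    fin_cases i <;> fin_cases k <;> simp [Fin.sum_univ_three, s7c0, s7s0]
  · rw [hG]
    change _ = Matrix.diagonal ![g0 x, g2 x, g1 x] i k
    fin_cases i <;> fin_cases k <;> simp [Fin.sum_univ_three, s7c1, s7s1]
  · rw [hG]
    change _ = p (Matrix.diagonal ![g0 x, g1 x, g2 x] i k)
    have h1 : ((s7c t * s7c t + s7s t * s7s t : ℝ) : ℂ) = 1 := by rw [s7cs]; simp
    push_cast at h1
    have h2 : (s7s t * s7s t + s7c t * s7c t : ℂ) = 1 := by rw [add_comm]; exact h1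
    fin_cases i <;> fin_cases k <;>
      simp [Fin.sum_univ_three, hp, ← add_smul, h1, h2] <;> ring_nf <;> simp

theorem s7_rot02 (b d : A →⋆ₙₐ[ℂ] E) (p : E →⋆ₙₐ[ℂ] E') (hp : ∀ x, p (b x) = p (d x)) :
    ∃ G G' : A →⋆ₙₐ[ℂ] Matrix (Fin 3) (Fin 3) C(unitInterval, E),
      (∀ x i k, G x i k 0 = s7D b 0 0 x i k) ∧ (∀ x i k, G x i k 1 = s7D 0 0 b x i k) ∧
      (∀ x i k, G' x i k 0 = s7D d 0 0 x i k) ∧ (∀ x i k, G' x i k 1 = s7D 0 0 d x i k) ∧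
      ∀ x i k t, p (G x i k t) = p (G' x i k t) := by
  have key : ∀ b : A →⋆ₙₐ[ℂ] E, ∃ G : A →⋆ₙₐ[ℂ] Matrix (Fin 3) (Fin 3) C(unitInterval, E),
    ∀ x i k t, G x i k t = ∑ l, (((!![s7c t, 0, s7s t; 0, 1, 0; -s7s t, 0, s7c t] :
      Matrix (Fin 3) (Fin 3) ℝ) i l * (!![s7c t, 0, s7s t; 0, 1, 0; -s7s t, 0, s7c t] :
      Matrix (Fin 3) (Fin 3) ℝ) k l : ℝ) : ℂ) • (![b, 0, 0] : Fin 3 → (A →⋆ₙₐ[ℂ] E)) l x := by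
    intro b
    refine s7_rot ![b, 0, 0]
      (fun t => !![s7c t, 0, s7s t; 0, 1, 0; -s7s t, 0, s7c t]) ?_ ?_
    · have := s7c_cont
      have := s7s_cont
      refine continuous_matrix fun i k => ?_
      fin_cases i <;> fin_cases k <;> simp <;> fun_prop
    · intro t
      have := s7cs t
      ext i k
      fin_cases i <;> fin_cases k <;>
        simp [Matrix.mul_apply, Fin.sum_univ_three, Matrix.one_apply] <;> linarith
  have h0 : ∀ b : A →⋆ₙₐ[ℂ] E, ∀ x i k, (∑ l, (((!![s7c 0, 0, s7s 0; 0, 1, 0; -s7s 0, 0, s7c 0] :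
      Matrix (Fin 3) (Fin 3) ℝ) i l * (!![s7c 0, 0, s7s 0; 0, 1, 0; -s7s 0, 0, s7c 0] :
      Matrix (Fin 3) (Fin 3) ℝ) k l : ℝ) : ℂ) • (![b, 0, 0] : Fin 3 → (A →⋆ₙₐ[ℂ] E)) l x) =
      s7D b 0 0 x i k := by
    intro b x i k
    change _ = Matrix.diagonal ![b x, 0, 0] i k
    fin_cases i <;> fin_cases k <;> simp [Fin.sum_univ_three, s7c0, s7s0]
  have h1 : ∀ b : A →⋆ₙₐ[ℂ] E, ∀ x i k, (∑ l, (((!![s7c 1, 0, s7s 1; 0, 1, 0; -s7s 1, 0, s7c 1] :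
      Matrix (Fin 3) (Fin 3) ℝ) i l * (!![s7c 1, 0, s7s 1; 0, 1, 0; -s7s 1, 0, s7c 1] :
      Matrix (Fin 3) (Fin 3) ℝ) k l : ℝ) : ℂ) • (![b, 0, 0] : Fin 3 → (A →⋆ₙₐ[ℂ] E)) l x) =
      s7D 0 0 b x i k := by
    intro b x i k
    change _ = Matrix.diagonal ![0, 0, b x] i k
    fin_cases i <;> fin_cases k <;> simp [Fin.sum_univ_three, s7c1, s7s1]
  obtain ⟨G, hG⟩ := key b
  obtain ⟨G', hG'⟩ := key d
  refine ⟨G, G', ?_, ?_, ?_, ?_, ?_⟩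
  · intro x i k; rw [hG, h0]
  · intro x i k; rw [hG, h1]
  · intro x i k; rw [hG', h0]
  · intro x i k; rw [hG', h1]
  · intro x i k t
    rw [hG, hG', map_sum, map_sum]
    refine Finset.sum_congr rfl fun l _ => ?_
    rw [map_smul, map_smul]
    congr 1
    fin_cases l
    · exact hp x
    · rfl
    · rfl

end Main

/-- padding as a homomorphism -/
def s7padHom (X : Type) [NonUnitalCStarAlgebra X] :
    Matrix (Fin 2) (Fin 2) X →⋆ₙₐ[ℂ] Matrix (Fin 3) (Fin 3) X where
  toFun := s7pad
  map_add' x y := by ext i k; fin_cases i <;> fin_cases k <;> simp [s7pad]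
  map_smul' c x := by ext i k; fin_cases i <;> fin_cases k <;> simp [s7pad]
  map_zero' := by ext i k; fin_cases i <;> fin_cases k <;> simp [s7pad]
  map_mul' x y := by
    ext i k; fin_cases i <;> fin_cases k <;>
      simp [s7pad, Matrix.mul_apply, Fin.sum_univ_three, Fin.sum_univ_two]
  map_star' x := by
    ext i k; fin_cases i <;> fin_cases k <;> simp [s7pad, Matrix.star_apply]


set_option maxHeartbeats 4000000 in
theorem statement7
    (A QA qA : Type)
    [NonUnitalCStarAlgebra A] [NonUnitalCStarAlgebra QA] [NonUnitalCStarAlgebra qA]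
    [TopologicalSpace.SeparableSpace A]
    -- `QA = A ⋆ A`, `qA = ker π₁`
    (P₁ : QPresentation A QA) (π₁ : QA →⋆ₙₐ[ℂ] A)
    (hπ₁ : ∀ x, π₁ (P₁.ι x) = x) (hπ₁' : ∀ x, π₁ (P₁.ιbar x) = x)
    (j₁ : qA →⋆ₙₐ[ℂ] QA) (hj₁ : Function.Injective j₁)
    (hr₁ : Set.range j₁ = {z : QA | π₁ z = 0})
    -- `QqA = qA ⋆ qA`, `q²A = ker π₂`
    (QqA q2A : Type) [NonUnitalCStarAlgebra QqA] [NonUnitalCStarAlgebra q2A]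
    (P₂ : QPresentation qA QqA) (π₂ : QqA →⋆ₙₐ[ℂ] qA)
    (hπ₂ : ∀ z, π₂ (P₂.ι z) = z) (hπ₂' : ∀ z, π₂ (P₂.ιbar z) = z)
    (j₂ : q2A →⋆ₙₐ[ℂ] QqA) (hj₂ : Function.Injective j₂)
    (hr₂ : Set.range j₂ = {v : QqA | π₂ v = 0})
    -- `π_A : qA → A` (restriction of `id ⋆ 0`) and `q(π_A) : q²A → qA`
    (θ : QA →⋆ₙₐ[ℂ] A) (hθ : ∀ x, θ (P₁.ι x) = x) (hθ' : ∀ x, θ (P₁.ιbar x) = 0)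
    (Φπ : QqA →⋆ₙₐ[ℂ] QA)
    (hΦπ : Φπ.comp P₂.ι = P₁.ι.comp (θ.comp j₁))
    (hΦπ' : Φπ.comp P₂.ιbar = P₁.ιbar.comp (θ.comp j₁))
    (qπA : q2A →⋆ₙₐ[ℂ] qA) (hqπA : ∀ w : q2A, j₁ (qπA w) = Φπ (j₂ w))
    -- stabilizations `KB = K ⊗ B`, `KC = K ⊗ C`
    (B KB C KC : Type) [NonUnitalCStarAlgebra B] [NonUnitalCStarAlgebra KB]
    [NonUnitalCStarAlgebra C] [NonUnitalCStarAlgebra KC]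
    (StB : Stabilization B KB) (StC : Stabilization C KC)
    -- `α : qA → K ⊗ B`, its extension `0 → B₀ → E_α → A → 0`
    (α : qA →⋆ₙₐ[ℂ] KB)
    (B₀T EαT : Type) [NonUnitalCStarAlgebra B₀T] [NonUnitalCStarAlgebra EαT]
    (ED : EalphaData A QA qA P₁ j₁ KB α B₀T EαT)
    -- `QB₀`, `qB₀`
    (QB₀ qB₀T : Type) [NonUnitalCStarAlgebra QB₀] [NonUnitalCStarAlgebra qB₀T]
    (PB₀ : QPresentation B₀T QB₀) (πB₀ : QB₀ →⋆ₙₐ[ℂ] B₀T)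
    (hπB₀ : ∀ x, πB₀ (PB₀.ι x) = x) (hπB₀' : ∀ x, πB₀ (PB₀.ιbar x) = x)
    (jqB₀ : qB₀T →⋆ₙₐ[ℂ] QB₀) (hjqB₀ : Function.Injective jqB₀)
    (hrqB₀ : Set.range jqB₀ = {z : QB₀ | πB₀ z = 0})
    -- the corestriction `α₀ : qA → B₀` of `α` and `q(α₀) : q²A → qB₀`
    (α₀ : qA →⋆ₙₐ[ℂ] B₀T) (hα₀ : ∀ z, ED.jB₀ (α₀ z) = α z)
    (Qα₀ : QqA →⋆ₙₐ[ℂ] QB₀)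
    (hQα₀ : Qα₀.comp P₂.ι = PB₀.ι.comp α₀) (hQα₀' : Qα₀.comp P₂.ιbar = PB₀.ιbar.comp α₀)
    (qα₀ : q2A →⋆ₙₐ[ℂ] qB₀T) (hqα₀ : ∀ w : q2A, jqB₀ (qα₀ w) = Qα₀ (j₂ w))
    -- `QE_α`, `qE_α`
    (QEα qEαT : Type) [NonUnitalCStarAlgebra QEα] [NonUnitalCStarAlgebra qEαT]
    (PE : QPresentation EαT QEα) (πE : QEα →⋆ₙₐ[ℂ] EαT)
    (hπE : ∀ x, πE (PE.ι x) = x) (hπE' : ∀ x, πE (PE.ιbar x) = x)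
    (jqE : qEαT →⋆ₙₐ[ℂ] QEα) (hjqE : Function.Injective jqE)
    (hrqE : Set.range jqE = {z : QEα | πE z = 0})
    -- `q(j_E) : qB₀ → qE_α`
    (QjE : QB₀ →⋆ₙₐ[ℂ] QEα)
    (hQjE : QjE.comp PB₀.ι = PE.ι.comp ED.jEB)
    (hQjE' : QjE.comp PB₀.ιbar = PE.ιbar.comp ED.jEB)
    (qjE : qB₀T →⋆ₙₐ[ℂ] qEαT) (hqjE : ∀ z : qB₀T, jqE (qjE z) = QjE (jqB₀ z))
    -- `β : qB₀ → K⊗C` and `β' : qE_α → K⊗C` extending `β` up to homotopy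
    (β : qB₀T →⋆ₙₐ[ℂ] KC) (β' : qEαT →⋆ₙₐ[ℂ] KC)
    (hext : HomHomotopic β (β'.comp qjE))
    -- `C₀`, the hereditary subalgebra of `K⊗C` generated by `β'(qE_α)`, and the
    -- extension `0 → C₀ → E_{β'} → E_α → 0` with splittings `β'_E, β̄'_E`
    (C₀T EβT : Type) [NonUnitalCStarAlgebra C₀T] [NonUnitalCStarAlgebra EβT]
    (EβD : EalphaData EαT QEα qEαT PE jqE KC β' C₀T EβT)
    -- the homomorphism `ω = q(β'_E α_E ⊕ β̄'_E ᾱ_E , β̄'_E α_E ⊕ β'_E ᾱ_E) : qA → M₂(C₀)`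
    (W : QA →⋆ₙₐ[ℂ] Matrix (Fin 2) (Fin 2) EβT)
    (hW : ∀ x : A, W (P₁.ι x) =
      Matrix.of ![![EβD.αE (ED.αE x), 0], ![0, EβD.αbarE (ED.αbarE x)]])
    (hW' : ∀ x : A, W (P₁.ιbar x) =
      Matrix.of ![![EβD.αbarE (ED.αE x), 0], ![0, EβD.αE (ED.αbarE x)]])
    (ω : qA →⋆ₙₐ[ℂ] Matrix (Fin 2) (Fin 2) KC)
    (hω : ∀ (z : qA) (i k : Fin 2), ∃ c : C₀T,
      EβD.jEB c = W (j₁ z) i k ∧ EβD.jB₀ c = ω z i k) :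
    -- conclusion: `β ∘ q(α₀) : q²A → C₀ ⊆ K⊗C` is homotopic to `ω ∘ q(π_A)`
    HomHomotopic ((cornerHom KC).comp (β.comp qα₀)) (ω.comp qπA) := by
  obtain ⟨pα, pα1, pα2, pα3, pα4, pα5, pα6⟩ := s7_EA ED π₁ hπ₁ hπ₁' hr₁
  obtain ⟨p, p1, p2, p3, p4, p5, p6⟩ := s7_EA EβD πE hπE hπE' hrqE
  obtain ⟨F₀, hF₀, hF₀'⟩ := s7_free_ex P₁ ED.αE ED.αbarE
  obtain ⟨Bt, hBt, hBt'⟩ := s7_free_ex PE EβD.αE EβD.αbarE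
  have hF₀j : ∀ z, F₀ (j₁ z) = ED.jEB (α₀ z) := by
    intro z
    obtain ⟨u, hu, hu'⟩ := pα6 F₀ hF₀ hF₀' z
    rw [← hu']
    congr 1
    apply ED.hjB₀inj
    rw [hu, hα₀]
  have hθπ : ∀ w, π₂ (j₂ w) = 0 := by
    intro w
    have : j₂ w ∈ Set.range j₂ := ⟨w, rfl⟩
    rwa [hr₂] at this
  have hπj : ∀ z, π₁ (j₁ z) = 0 := by
    intro z
    have : j₁ z ∈ Set.range j₁ := ⟨z, rfl⟩
    rwa [hr₁] at this
  let a : A →⋆ₙₐ[ℂ] EβT := EβD.αE.comp ED.αE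
  let b : A →⋆ₙₐ[ℂ] EβT := EβD.αE.comp ED.αbarE
  let c : A →⋆ₙₐ[ℂ] EβT := EβD.αbarE.comp ED.αE
  let d : A →⋆ₙₐ[ℂ] EβT := EβD.αbarE.comp ED.αbarE
  have hac : ∀ x, p (a x) = p (c x) := fun x => (p1 (ED.αE x)).trans (p2 (ED.αE x)).symm
  have hbd : ∀ x, p (b x) = p (d x) := fun x => (p1 (ED.αbarE x)).trans (p2 (ED.αbarE x)).symm
  obtain ⟨f, hf⟩ := s7_const a d b
  obtain ⟨f2, hf2⟩ := s7_const c b d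
  obtain ⟨kb, hkb⟩ := s7_const b 0 0
  obtain ⟨kd, hkd⟩ := s7_const d 0 0
  obtain ⟨g, g0, g1, gp⟩ := s7_rot12 c b d p hbd
  obtain ⟨r, r', r0, r1, r0', r1', rp⟩ := s7_rot02 b d p hbd
  have hdiag : ∀ x i k, p (s7D a d b x i k) = p (s7D c b d x i k) := by
    intro x i k
    change p (Matrix.diagonal ![a x, d x, b x] i k) = p (Matrix.diagonal ![c x, b x, d x] i k)
    fin_cases i <;> fin_cases k <;> simp [hac, hbd]
  have hdiag2 : ∀ x i k, p (s7D b 0 0 x i k) = p (s7D d 0 0 x i k) := by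
    intro x i k
    change p (Matrix.diagonal ![b x, 0, 0] i k) = p (Matrix.diagonal ![d x, 0, 0] i k)
    fin_cases i <;> fin_cases k <;> simp [hbd]
  obtain ⟨T1, T1c, hT1⟩ := s7_stage P₁ j₁ P₂ π₂ hπ₂ hπ₂' j₂ hr₂ p EβD.jEB p5 p4 EβD.jB₀ f kb g kd
    (fun x i k t => by rw [hf, gp, hdiag]) (fun x i k t => by rw [hkb, hkd, hdiag2])
  obtain ⟨T2, T2c, hT2⟩ := s7_stage P₁ j₁ P₂ π₂ hπ₂ hπ₂' j₂ hr₂ p EβD.jEB p5 p4 EβD.jB₀ f r f2 r'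
    (fun x i k t => by rw [hf, hf2, hdiag]) rp
  -- the common start point
  have h0 : T1 0 = T2 0 := by
    obtain ⟨F, hF, hF'⟩ := s7_free_ex_mat P₁ (s7D a d b) (s7D b 0 0)
    obtain ⟨G, hG, hG'⟩ := s7_free_ex_mat P₁ (s7D c b d) (s7D d 0 0)
    obtain ⟨h, hh, hh'⟩ := s7_free_ex_mat P₂ (F.comp j₁) (G.comp j₁)
    apply NonUnitalStarAlgHom.ext
    intro w
    ext i k
    obtain ⟨c1, e1, e1'⟩ := hT1 0 F G h (fun x i k => by rw [hF, hf])
      (fun x i k => by rw [hF', hkb]) (fun x i k => by rw [hG, g0])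
      (fun x i k => by rw [hG', hkd]) hh hh' w i k
    obtain ⟨c2, e2, e2'⟩ := hT2 0 F G h (fun x i k => by rw [hF, hf])
      (fun x i k => by rw [hF', r0]) (fun x i k => by rw [hG, hf2])
      (fun x i k => by rw [hG', r0']) hh hh' w i k
    rw [← e1', ← e2', p5 (e1.trans e2.symm)]
  -- the first end point
  have hend1 : ∀ w, T1 1 w = s7pad (cornerHom KC (β' (qjE (qα₀ w)))) := by
    intro w
    let F := s7D (EβD.αE.comp F₀) (d.comp θ) (b.comp θ)
    let G := s7D (EβD.αbarE.comp F₀) (d.comp θ) (b.comp θ)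
    let h := s7D (Bt.comp (QjE.comp Qα₀)) ((d.comp θ).comp (j₁.comp π₂))
      ((b.comp θ).comp (j₁.comp π₂))
    have q1 : ∀ z, Qα₀ (P₂.ι z) = PB₀.ι (α₀ z) := fun z => DFunLike.congr_fun hQα₀ z
    have q1' : ∀ z, Qα₀ (P₂.ιbar z) = PB₀.ιbar (α₀ z) := fun z => DFunLike.congr_fun hQα₀' z
    have q2 : ∀ z, QjE (PB₀.ι z) = PE.ι (ED.jEB z) := fun z => DFunLike.congr_fun hQjE z
    have q2' : ∀ z, QjE (PB₀.ιbar z) = PE.ιbar (ED.jEB z) := fun z => DFunLike.congr_fun hQjE' z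
    obtain ⟨u, hu, hu'⟩ := p6 Bt hBt hBt' (qjE (qα₀ w))
    have hw : h (j₂ w) = Matrix.diagonal ![EβD.jEB u, 0, 0] := by
      change Matrix.diagonal ![Bt (QjE (Qα₀ (j₂ w))), d (θ (j₁ (π₂ (j₂ w)))),
        b (θ (j₁ (π₂ (j₂ w))))] = _
      rw [hθπ, map_zero, map_zero, map_zero, map_zero, hu', hqjE, hqα₀]
    have key := hT1 1 F G h
      (fun x i k => by
        rw [hf]
        change Matrix.diagonal ![EβD.αE (F₀ (P₁.ι x)), d (θ (P₁.ι x)), b (θ (P₁.ι x))] i k =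
          Matrix.diagonal ![EβD.αE (ED.αE x), d x, b x] i k
        rw [hF₀, hθ])
      (fun x i k => by
        rw [hkb]
        change Matrix.diagonal ![EβD.αE (F₀ (P₁.ιbar x)), d (θ (P₁.ιbar x)),
          b (θ (P₁.ιbar x))] i k = Matrix.diagonal ![EβD.αE (ED.αbarE x), 0, 0] i k
        rw [hF₀', hθ', map_zero, map_zero])
      (fun x i k => by
        rw [g1]
        change Matrix.diagonal ![EβD.αbarE (F₀ (P₁.ι x)), d (θ (P₁.ι x)), b (θ (P₁.ι x))] i k =
          Matrix.diagonal ![EβD.αbarE (ED.αE x), d x, b x] i k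
        rw [hF₀, hθ])
      (fun x i k => by
        rw [hkd]
        change Matrix.diagonal ![EβD.αbarE (F₀ (P₁.ιbar x)), d (θ (P₁.ιbar x)),
          b (θ (P₁.ιbar x))] i k = Matrix.diagonal ![EβD.αbarE (ED.αbarE x), 0, 0] i k
        rw [hF₀', hθ', map_zero, map_zero])
      (fun z => by
        change Matrix.diagonal ![Bt (QjE (Qα₀ (P₂.ι z))), d (θ (j₁ (π₂ (P₂.ι z)))),
          b (θ (j₁ (π₂ (P₂.ι z))))] = Matrix.diagonal ![EβD.αE (F₀ (j₁ z)), d (θ (j₁ z)),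
          b (θ (j₁ z))]
        rw [q1, q2, hBt, hπ₂, hF₀j])
      (fun z => by
        change Matrix.diagonal ![Bt (QjE (Qα₀ (P₂.ιbar z))), d (θ (j₁ (π₂ (P₂.ιbar z)))),
          b (θ (j₁ (π₂ (P₂.ιbar z))))] = Matrix.diagonal ![EβD.αbarE (F₀ (j₁ z)), d (θ (j₁ z)),
          b (θ (j₁ z))]
        rw [q1', q2', hBt', hπ₂', hF₀j])
      w
    rw [hw] at key
    have key0 : ∀ i k, EβD.jEB (Matrix.diagonal ![u, 0, 0] i k) =
        Matrix.diagonal ![EβD.jEB u, 0, 0] i k := by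
      intro i k
      fin_cases i <;> fin_cases k <;> simp
    ext i k
    obtain ⟨c1, e1, e1'⟩ := key i k
    rw [← key0] at e1
    rw [← e1', p5 e1]
    fin_cases i <;> fin_cases k <;> simp [s7pad, cornerHom, hu]
  -- the second end point
  have hend2 : ∀ w, T2 1 w = s7pad (ω (qπA w)) := by
    intro w
    let F := s7D (a.comp θ) (d.comp θ) (b.comp π₁)
    let G := s7D (c.comp θ) (b.comp θ) (d.comp π₁)
    let h := (s7padHom EβT).comp (W.comp Φπ)
    have q1 : ∀ z, Φπ (P₂.ι z) = P₁.ι (θ (j₁ z)) := fun z => DFunLike.congr_fun hΦπ z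
    have q1' : ∀ z, Φπ (P₂.ιbar z) = P₁.ιbar (θ (j₁ z)) := fun z => DFunLike.congr_fun hΦπ' z
    have key := hT2 1 F G h
      (fun x i k => by
        rw [hf]
        change Matrix.diagonal ![a (θ (P₁.ι x)), d (θ (P₁.ι x)), b (π₁ (P₁.ι x))] i k =
          Matrix.diagonal ![a x, d x, b x] i k
        rw [hπ₁, hθ])
      (fun x i k => by
        rw [r1]
        change Matrix.diagonal ![a (θ (P₁.ιbar x)), d (θ (P₁.ιbar x)), b (π₁ (P₁.ιbar x))] i k =
          Matrix.diagonal ![0, 0, b x] i k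
        rw [hπ₁', hθ', map_zero, map_zero])
      (fun x i k => by
        rw [hf2]
        change Matrix.diagonal ![c (θ (P₁.ι x)), b (θ (P₁.ι x)), d (π₁ (P₁.ι x))] i k =
          Matrix.diagonal ![c x, b x, d x] i k
        rw [hπ₁, hθ])
      (fun x i k => by
        rw [r1']
        change Matrix.diagonal ![c (θ (P₁.ιbar x)), b (θ (P₁.ιbar x)), d (π₁ (P₁.ιbar x))] i k =
          Matrix.diagonal ![0, 0, d x] i k
        rw [hπ₁', hθ', map_zero, map_zero])
      (fun z => by
        change s7pad (W (Φπ (P₂.ι z))) = Matrix.diagonal ![EβD.αE (ED.αE (θ (j₁ z))),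
          EβD.αbarE (ED.αbarE (θ (j₁ z))), b (π₁ (j₁ z))]
        rw [q1, hW, hπj, map_zero]
        ext i k
        fin_cases i <;> fin_cases k <;> simp [s7pad])
      (fun z => by
        change s7pad (W (Φπ (P₂.ιbar z))) = Matrix.diagonal ![EβD.αbarE (ED.αE (θ (j₁ z))),
          EβD.αE (ED.αbarE (θ (j₁ z))), d (π₁ (j₁ z))]
        rw [q1', hW', hπj, map_zero]
        ext i k
        fin_cases i <;> fin_cases k <;> simp [s7pad])
      w
    have hw : h (j₂ w) = s7pad (W (j₁ (qπA w))) := by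
      change s7pad (W (Φπ (j₂ w))) = _
      rw [hqπA]
    rw [hw] at key
    choose v hv hv' using hω (qπA w)
    ext i k
    obtain ⟨c1, e1, e1'⟩ := key i k
    have e2 : EβD.jEB (s7pad (Matrix.of v) i k) = s7pad (W (j₁ (qπA w))) i k := by
      fin_cases i <;> fin_cases k <;> simp [s7pad, hv]
    rw [← e2] at e1
    rw [← e1', p5 e1]
    fin_cases i <;> fin_cases k <;> simp [s7pad, hv']
  obtain ⟨Ψ, Ψc, H, Hc, H0, hΨ⟩ := s7_stab StC
  have hstab : ∀ f : q2A →⋆ₙₐ[ℂ] Matrix (Fin 2) (Fin 2) KC,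
      HomHomotopic f ((matMap₂ (H 1)).comp f) := by
    intro f
    refine ⟨fun t => (matMap₂ (H t)).comp f, fun w => ?_, ?_, rfl⟩
    · refine continuous_matrix fun i k => ?_
      exact Hc (f w i k)
    · apply NonUnitalStarAlgHom.ext
      intro w
      ext i k
      exact H0 _
  have hmid1 : HomHomotopic (T1 0) (T1 1) := ⟨T1, T1c, rfl, rfl⟩
  have hmid2 : HomHomotopic (T2 0) (T2 1) := ⟨T2, T2c, rfl, rfl⟩
  have hcorner : Continuous (cornerHom KC) := by
    refine continuous_matrix fun i k => ?_
    change Continuous fun x : KC => if i = 0 ∧ k = 0 then x else 0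
    split_ifs
    · exact continuous_id
    · exact continuous_const
  have s1 : HomHomotopic ((cornerHom KC).comp (β.comp qα₀))
      ((cornerHom KC).comp ((β'.comp qjE).comp qα₀)) :=
    s7_comp_left (s7_comp_right hext qα₀) _ hcorner
  have s2 := hstab ((cornerHom KC).comp ((β'.comp qjE).comp qα₀))
  have e2 : (matMap₂ (H 1)).comp ((cornerHom KC).comp ((β'.comp qjE).comp qα₀)) =
      Ψ.comp (T1 1) := by
    apply NonUnitalStarAlgHom.ext
    intro w
    change matMap₂ (H 1) (cornerHom KC (β' (qjE (qα₀ w)))) = Ψ (T1 1 w)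
    rw [hend1, hΨ]
  have s3 := s7_comp_left (s7_symm hmid1) Ψ Ψc
  have s4 := s7_comp_left hmid2 Ψ Ψc
  have e4 : Ψ.comp (T2 1) = (matMap₂ (H 1)).comp (ω.comp qπA) := by
    apply NonUnitalStarAlgHom.ext
    intro w
    change Ψ (T2 1 w) = matMap₂ (H 1) (ω (qπA w))
    rw [hend2, hΨ]
  rw [e2] at s2
  rw [h0] at s3
  rw [e4] at s4
  exact s7_trans s1 (s7_trans s2 (s7_trans s3 (s7_trans s4 (s7_symm (hstab _)))))
end
end

section
/- Let X be a topological space, let A and B be C*-algebras with an action of X, and let φ : qA → B be a *-homomorphism. Then the following are equivalent: (1) φ is weakly X-equivariant, i.e. for each z ∈ qA the linear maps A ∋ x ↦ φ(ι(x)z) and x ↦ φ(ῑ(x)z) are X-equivariant; (2) φ is q_X-equivariant, i.e. the linear map A ∋ x ↦ φ(qx) is X-equivariant; (3) φ is X-equivariant as a homomorphism q_X A → B, i.e. φ(q_X A(U)) ⊆ B(U) for every open U ⊆ X. -/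
/-!
Statement 9 (Proposition 4.2): for C*-algebras `A`, `B` with an action of a
topological space `X` and a *-homomorphism `φ : qA → B`, the following are
equivalent:
(1) `φ` is weakly `X`-equivariant (for each `z ∈ qA` the maps `x ↦ φ(ι(x)z)` and
    `x ↦ φ(ῑ(x)z)` are `X`-equivariant);
(2) `φ` is `q_X`-equivariant (the map `x ↦ φ(qx)` is `X`-equivariant);
(3) `φ` is `X`-equivariant as a homomorphism `q_X A → B`, where `q_X A(U)` is the
    closed two-sided ideal of `qA` generated by `Q(A(U))·qA + qA·Q(A(U))`.

Here `QA = A ⋆ A` is the free product with inclusions `ι, ῑ`, `qA = ker (QA → A)`,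
`qx = ι x - ῑ x`; `qA` is presented abstractly as a C*-algebra with an embedding
`j : qA → QA` onto the kernel, and `qe : A → qA` satisfies `j (qe x) = qx`.
An action of `X` on `A` is an order preserving map from open sets of `X` to closed
two-sided ideals of `A`.
-/

noncomputable section

/-- `q x = ι x - ῑ x`. -/
def QPresentation.q {A Q : Type} [NonUnitalCStarAlgebra A] [NonUnitalCStarAlgebra Q]
    (P : QPresentation A Q) (x : A) : Q := P.ι x - P.ιbar x

/-- An action of a topological space `X` on a C*-algebra `A`: an order preserving
map from the open subsets of `X` to the closed two-sided ideals of `A`. -/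
structure XAction (X A : Type) [TopologicalSpace X] [NonUnitalCStarAlgebra A] where
  ideal : TopologicalSpace.Opens X → TwoSidedIdeal A
  closed : ∀ U, IsClosed ((ideal U : Set A))
  mono : ∀ U V, U ≤ V → ideal U ≤ ideal V

theorem aux_cont {C D : Type} [NonUnitalCStarAlgebra C] [NonUnitalCStarAlgebra D]
    (f : C →⋆ₙₐ[ℂ] D) : Continuous f :=
  AddMonoidHomClass.continuous_of_bound f 1
    (fun x => by simpa using NonUnitalStarAlgHom.norm_apply_le f x)

open Filter Topology in
theorem aux_right {C : Type} [NonUnitalCStarAlgebra C] (I : TwoSidedIdeal C)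
    (hI : IsClosed (I : Set C)) (w : C) (h : ∀ e, w * e ∈ I) : w ∈ I := by
  let _ := CStarAlgebra.spectralOrder C
  have := CStarAlgebra.spectralOrderedRing C
  have h1 := (CStarAlgebra.increasingApproximateUnit C).tendsto_mul_left w
  exact hI.mem_of_tendsto h1 (Eventually.of_forall h)

open Filter Topology in
theorem aux_left {C : Type} [NonUnitalCStarAlgebra C] (I : TwoSidedIdeal C)
    (hI : IsClosed (I : Set C)) (w : C) (h : ∀ e, e * w ∈ I) : w ∈ I := by
  let _ := CStarAlgebra.spectralOrder C
  have := CStarAlgebra.spectralOrderedRing C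
  have h1 := (CStarAlgebra.increasingApproximateUnit C).tendsto_mul_right w
  exact hI.mem_of_tendsto h1 (Eventually.of_forall h)

/-- `Q` is generated by the two copies of `A`. -/
theorem aux_gen {A Q : Type} [NonUnitalCStarAlgebra A] [NonUnitalCStarAlgebra Q]
    (P : QPresentation A Q) (T : NonUnitalStarSubalgebra ℂ Q) (hT : IsClosed (T : Set Q))
    (h1 : ∀ a, P.ι a ∈ T) (h2 : ∀ a, P.ιbar a ∈ T) (z : Q) : z ∈ T := by
  have : IsClosed (T : Set Q) := hT
  have : CompleteSpace T := hT.completeSpace_coe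
  let : NonUnitalCStarAlgebra T := {}
  obtain ⟨h, ⟨ha, hb⟩, -⟩ := P.free T (NonUnitalStarAlgHom.codRestrict P.ι T h1)
    (NonUnitalStarAlgHom.codRestrict P.ιbar T h2)
  obtain ⟨k, -, hk⟩ := P.free Q P.ι P.ιbar
  have e1 := hk ((NonUnitalStarSubalgebraClass.subtype T).comp h) ⟨by
    ext a; exact congrArg Subtype.val (DFunLike.congr_fun ha a), by
    ext a; exact congrArg Subtype.val (DFunLike.congr_fun hb a)⟩
  have e2 := hk (NonUnitalStarAlgHom.id ℂ Q) ⟨by ext a; rfl, by ext a; rfl⟩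
  have e3 := DFunLike.congr_fun (e1.trans e2.symm) z
  have e4 : ((h z : T) : Q) = z := e3
  rw [← e4]
  exact (h z).2

/-- If `S` is closed, contains all `q a`, closed under addition etc., it contains `ker π`. -/
theorem aux_ker {A Q : Type} [NonUnitalCStarAlgebra A] [NonUnitalCStarAlgebra Q]
    (P : QPresentation A Q) (π : Q →⋆ₙₐ[ℂ] A)
    (hπ : ∀ x, π (P.ι x) = x) (hπ' : ∀ x, π (P.ιbar x) = x)
    (S : Set Q) (hS : IsClosed S) (h0 : (0 : Q) ∈ S)
    (hadd : ∀ a ∈ S, ∀ b ∈ S, a + b ∈ S) (hmul : ∀ a ∈ S, ∀ b ∈ S, a * b ∈ S)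
    (hsmul : ∀ c : ℂ, ∀ a ∈ S, c • a ∈ S)
    (hl : ∀ x, ∀ a ∈ S, P.ι x * a ∈ S) (hr : ∀ x, ∀ a ∈ S, a * P.ι x ∈ S)
    (hq : ∀ x, P.q x ∈ S) (z : Q) (hz : π z = 0) : z ∈ S := by
  have key : ∀ a b : Q, a - P.ι (π a) ∈ S → b - P.ι (π b) ∈ S →
      a * b - P.ι (π (a * b)) ∈ S := by
    intro a b ha hb
    have : a * b - P.ι (π (a * b)) = (a - P.ι (π a)) * (b - P.ι (π b)) +
        ((a - P.ι (π a)) * P.ι (π b) + P.ι (π a) * (b - P.ι (π b))) := by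
      simp only [map_mul]; noncomm_ring
    rw [this]
    exact hadd _ (hmul _ ha _ hb) _ (hadd _ (hr _ _ ha) _ (hl _ _ hb))
  have kadd : ∀ a b : Q, a - P.ι (π a) ∈ S → b - P.ι (π b) ∈ S →
      (a + b) - P.ι (π (a + b)) ∈ S := by
    intro a b ha hb
    have : (a + b) - P.ι (π (a + b)) = (a - P.ι (π a)) + (b - P.ι (π b)) := by
      simp only [map_add]; abel
    rw [this]
    exact hadd _ ha _ hb
  have ksm : ∀ (c : ℂ) (a : Q), a - P.ι (π a) ∈ S → c • a - P.ι (π (c • a)) ∈ S := by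
    intro c a ha
    have : c • a - P.ι (π (c • a)) = c • (a - P.ι (π a)) := by
      simp only [map_smul, smul_sub]
    rw [this]
    exact hsmul _ _ ha
  have kbar : ∀ x, P.ιbar x - P.ι (π (P.ιbar x)) ∈ S := by
    intro x
    have : P.ιbar x - P.ι (π (P.ιbar x)) = (-1 : ℂ) • P.q x := by
      rw [hπ', QPresentation.q, neg_smul, one_smul]; abel
    rw [this]
    exact hsmul _ _ (hq x)
  have kio : ∀ x, P.ι x - P.ι (π (P.ι x)) ∈ S := by
    intro x
    rw [hπ, sub_self]; exact h0
  have hcι : Continuous P.ι := aux_cont P.ι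
  have hcπ : Continuous π := aux_cont π
  let T : NonUnitalStarSubalgebra ℂ Q :=
    { carrier := {a | a - P.ι (π a) ∈ S ∧ star a - P.ι (π (star a)) ∈ S}
      add_mem' := by
        rintro a b ⟨ha, ha'⟩ ⟨hb, hb'⟩
        refine ⟨kadd _ _ ha hb, ?_⟩
        rw [star_add]; exact kadd _ _ ha' hb'
      zero_mem' := by simpa using h0
      mul_mem' := by
        rintro a b ⟨ha, ha'⟩ ⟨hb, hb'⟩
        refine ⟨key _ _ ha hb, ?_⟩
        rw [star_mul]; exact key _ _ hb' ha'
      smul_mem' := by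
        rintro c a ⟨ha, ha'⟩
        refine ⟨ksm _ _ ha, ?_⟩
        rw [star_smul]; exact ksm _ _ ha'
      star_mem' := by
        rintro a ⟨ha, ha'⟩
        refine ⟨ha', ?_⟩
        rw [star_star]; exact ha }
  have hT : IsClosed (T : Set Q) := by
    apply IsClosed.inter
    · exact hS.preimage (continuous_id.sub (hcι.comp hcπ))
    · exact hS.preimage (continuous_star.sub (hcι.comp (hcπ.comp continuous_star)))
  have hzT : z ∈ T := aux_gen P T hT
    (fun a => ⟨kio a, by rw [← map_star]; exact kio _⟩)
    (fun a => ⟨kbar a, by rw [← map_star]; exact kbar _⟩) z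
  have := hzT.1
  rwa [hz, map_zero, sub_zero] at this

/-- Main step. -/
theorem aux_main {A Q qA : Type} [NonUnitalCStarAlgebra A]
    [NonUnitalCStarAlgebra Q] [NonUnitalCStarAlgebra qA]
    (P : QPresentation A Q) (π : Q →⋆ₙₐ[ℂ] A)
    (hπ : ∀ x, π (P.ι x) = x) (hπ' : ∀ x, π (P.ιbar x) = x)
    (j : qA →⋆ₙₐ[ℂ] Q) (hj : Function.Injective j)
    (hrange : Set.range j = {z : Q | π z = 0})
    (qe : A → qA) (hqe : ∀ x : A, j (qe x) = P.q x)
    (K : TwoSidedIdeal A) (J : TwoSidedIdeal qA) (hJ : IsClosed (J : Set qA))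
    (h : ∀ x ∈ K, qe x ∈ J) (x : A) (hx : x ∈ K) (z w : qA)
    (hw : j w = P.ι x * j z ∨ j w = P.ιbar x * j z ∨
              j w = j z * P.ι x ∨ j w = j z * P.ιbar x) : w ∈ J := by
  have hker : ∀ v : qA, π (j v) = 0 := fun v => by
    have : j v ∈ Set.range j := ⟨v, rfl⟩
    rwa [hrange] at this
  have hlift : ∀ b : Q, π b = 0 → ∃ v, j v = b := fun b hb => by
    have : b ∈ Set.range j := by rw [hrange]; exact hb
    exact this
  let J' : Set Q := j '' (J : Set qA)
  have J'closed : IsClosed J' :=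
    (NonUnitalStarAlgHom.isometry j hj).isClosedEmbedding.isClosedMap _ hJ
  have J'0 : (0 : Q) ∈ J' := ⟨0, J.zero_mem, map_zero j⟩
  have J'add : ∀ a ∈ J', ∀ b ∈ J', a + b ∈ J' := by
    rintro _ ⟨a, ha, rfl⟩ _ ⟨b, hb, rfl⟩
    exact ⟨a + b, J.add_mem ha hb, map_add j a b⟩
  have J'sub : ∀ a ∈ J', ∀ b ∈ J', a - b ∈ J' := by
    rintro _ ⟨a, ha, rfl⟩ _ ⟨b, hb, rfl⟩
    exact ⟨a - b, J.sub_mem ha hb, map_sub j a b⟩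
  have J'smul : ∀ c : ℂ, ∀ a ∈ J', c • a ∈ J' := by
    rintro c _ ⟨a, ha, rfl⟩
    refine ⟨c • a, aux_right J hJ _ fun e => ?_, map_smul j c a⟩
    rw [smul_mul_assoc, ← mul_smul_comm]
    exact J.mul_mem_right _ _ ha
  have J'r : ∀ a ∈ J', ∀ b : Q, a * b ∈ J' := by
    rintro _ ⟨a, ha, rfl⟩ b
    obtain ⟨v, hv⟩ := hlift (j a * b) (by rw [map_mul, hker, zero_mul])
    refine ⟨v, aux_right J hJ _ fun e => ?_, hv⟩
    obtain ⟨u, hu⟩ := hlift (b * j e) (by rw [map_mul, hker, mul_zero])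
    have : v * e = a * u := hj (by rw [map_mul, map_mul, hv, hu, mul_assoc])
    rw [this]
    exact J.mul_mem_right _ _ ha
  have J'l : ∀ a ∈ J', ∀ b : Q, b * a ∈ J' := by
    rintro _ ⟨a, ha, rfl⟩ b
    obtain ⟨v, hv⟩ := hlift (b * j a) (by rw [map_mul, hker, mul_zero])
    refine ⟨v, aux_left J hJ _ fun e => ?_, hv⟩
    obtain ⟨u, hu⟩ := hlift (j e * b) (by rw [map_mul, hker, zero_mul])
    have : e * v = u * a := hj (by rw [map_mul, map_mul, hv, hu, mul_assoc])
    rw [this]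
    exact J.mul_mem_left _ _ ha
  have hq : ∀ x ∈ K, P.q x ∈ J' := fun x hx => ⟨qe x, h x hx, hqe x⟩
  let S : Set Q := {z | ∀ x ∈ K, P.ι x * z ∈ J' ∧ z * P.ι x ∈ J'}
  have hSz : ∀ z : qA, j z ∈ S := by
    intro z
    refine aux_ker P π hπ hπ' S ?_ ?_ ?_ ?_ ?_ ?_ ?_ ?_ (j z) (hker z)
    · have : S = ⋂ x ∈ K, ((fun z => P.ι x * z) ⁻¹' J' ∩ (fun z => z * P.ι x) ⁻¹' J') := by
        ext z; simp [S]
      rw [this]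
      refine isClosed_biInter fun x _ => ?_
      exact (J'closed.preimage (continuous_const.mul continuous_id)).inter
        (J'closed.preimage (continuous_id.mul continuous_const))
    · intro x _; simpa using J'0
    · intro a ha b hb x hx
      rw [mul_add, add_mul]
      exact ⟨J'add _ (ha x hx).1 _ (hb x hx).1, J'add _ (ha x hx).2 _ (hb x hx).2⟩
    · intro a ha b hb x hx
      rw [← mul_assoc, mul_assoc a b]
      exact ⟨J'r _ (ha x hx).1 _, J'l _ (hb x hx).2 _⟩
    · intro c a ha x hx
      rw [mul_smul_comm, smul_mul_assoc]
      exact ⟨J'smul _ _ (ha x hx).1, J'smul _ _ (ha x hx).2⟩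
    · intro y a ha x hx
      rw [← mul_assoc, ← map_mul, mul_assoc (P.ι y)]
      exact ⟨(ha _ (K.mul_mem_right _ _ hx)).1, J'l _ (ha x hx).2 _⟩
    · intro y a ha x hx
      rw [← mul_assoc, mul_assoc a, ← map_mul]
      exact ⟨J'r _ (ha x hx).1 _, (ha _ (K.mul_mem_left _ _ hx)).2⟩
    · intro y x hx
      have e1 : P.ι x * P.q y = P.q (x * y) - P.q x * P.ιbar y := by
        simp only [QPresentation.q, map_mul]; noncomm_ring
      have e2 : P.q y * P.ι x = P.q (y * x) - P.ιbar y * P.q x := by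
        simp only [QPresentation.q, map_mul]; noncomm_ring
      rw [e1, e2]
      exact ⟨J'sub _ (hq _ (K.mul_mem_right _ _ hx)) _ (J'r _ (hq x hx) _),
        J'sub _ (hq _ (K.mul_mem_left _ _ hx)) _ (J'l _ (hq x hx) _)⟩
  have fin : j w ∈ J' := by
    rcases hw with hw | hw | hw | hw
    · rw [hw]; exact (hSz z x hx).1
    · have : j w = P.ι x * j z - P.q x * j z := by
        rw [hw, QPresentation.q]; noncomm_ring
      rw [this]; exact J'sub _ (hSz z x hx).1 _ (J'r _ (hq x hx) _)
    · rw [hw]; exact (hSz z x hx).2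
    · have : j w = j z * P.ι x - j z * P.q x := by
        rw [hw, QPresentation.q]; noncomm_ring
      rw [this]; exact J'sub _ (hSz z x hx).2 _ (J'l _ (hq x hx) _)
  obtain ⟨v, hv, hvw⟩ := fin
  rwa [← hj hvw]

theorem aux_conv {A Q qA : Type} [NonUnitalCStarAlgebra A]
    [NonUnitalCStarAlgebra Q] [NonUnitalCStarAlgebra qA]
    (P : QPresentation A Q) (π : Q →⋆ₙₐ[ℂ] A)
    (j : qA →⋆ₙₐ[ℂ] Q) (hj : Function.Injective j)
    (hrange : Set.range j = {z : Q | π z = 0})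
    (qe : A → qA) (hqe : ∀ x : A, j (qe x) = P.q x)
    (J : TwoSidedIdeal qA) (hJ : IsClosed (J : Set qA)) (x : A)
    (h : ∀ z w : qA, (j w = P.ι x * j z ∨ j w = P.ιbar x * j z) → w ∈ J) : qe x ∈ J := by
  have hker : ∀ v : qA, π (j v) = 0 := fun v => by
    have : j v ∈ Set.range j := ⟨v, rfl⟩
    rwa [hrange] at this
  have hlift : ∀ b : Q, π b = 0 → ∃ v, j v = b := fun b hb => by
    have : b ∈ Set.range j := by rw [hrange]; exact hb
    exact this
  refine aux_right J hJ _ fun e => ?_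
  obtain ⟨u, hu⟩ := hlift (P.ι x * j e) (by rw [map_mul, hker, mul_zero])
  obtain ⟨v, hv⟩ := hlift (P.ιbar x * j e) (by rw [map_mul, hker, mul_zero])
  have : qe x * e = u - v := hj (by
    rw [map_mul, map_sub, hu, hv, hqe, QPresentation.q, sub_mul])
  rw [this]
  exact J.sub_mem (h e u (Or.inl hu)) (h e v (Or.inr hv))

theorem statement9
    (X : Type) [TopologicalSpace X]
    (A B Q qA : Type) [NonUnitalCStarAlgebra A] [NonUnitalCStarAlgebra B]
    [NonUnitalCStarAlgebra Q] [NonUnitalCStarAlgebra qA]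
    (P : QPresentation A Q) (π : Q →⋆ₙₐ[ℂ] A)
    (hπ : ∀ x, π (P.ι x) = x) (hπ' : ∀ x, π (P.ιbar x) = x)
    -- `qA` is (a presentation of) the kernel of `π`
    (j : qA →⋆ₙₐ[ℂ] Q) (hj : Function.Injective j)
    (hrange : Set.range j = {z : Q | π z = 0})
    (qe : A → qA) (hqe : ∀ x : A, j (qe x) = P.q x)
    -- actions of `X` on `A` and `B`
    (actA : XAction X A) (actB : XAction X B)
    -- a *-homomorphism `φ : qA → B`
    (φ : qA →⋆ₙₐ[ℂ] B) :
    -- (1) ↔ (2) ↔ (3)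
    ((∀ U, ∀ x ∈ actA.ideal U, ∀ z w : qA,
        (j w = P.ι x * j z ∨ j w = P.ιbar x * j z) → φ w ∈ actB.ideal U) ↔
      (∀ U, ∀ x ∈ actA.ideal U, φ (qe x) ∈ actB.ideal U)) ∧
    ((∀ U, ∀ x ∈ actA.ideal U, φ (qe x) ∈ actB.ideal U) ↔
      (∀ U, ∀ w : qA,
        -- `w ∈ q_X A (U)`, the closed two-sided ideal of `qA` generated by
        -- `Q(A(U)) qA + qA Q(A(U))`
        (∀ I : TwoSidedIdeal qA, IsClosed ((I : Set qA)) →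
          ({w' : qA | ∃ x ∈ actA.ideal U, ∃ z : qA,
              j w' = P.ι x * j z ∨ j w' = P.ιbar x * j z ∨
              j w' = j z * P.ι x ∨ j w' = j z * P.ιbar x} ⊆ (I : Set qA)) →
          w ∈ I) →
        φ w ∈ actB.ideal U)) := by
  have hφc : Continuous φ := aux_cont φ
  let J : TopologicalSpace.Opens X → TwoSidedIdeal qA := fun U => (actB.ideal U).comap φ
  have hJm : ∀ U w, w ∈ J U ↔ φ w ∈ actB.ideal U := fun U w => TwoSidedIdeal.mem_comap φ
  have hJ : ∀ U, IsClosed (J U : Set qA) := fun U => by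
    have : (J U : Set qA) = φ ⁻¹' (actB.ideal U : Set B) := by
      ext w; exact hJm U w
    rw [this]; exact (actB.closed U).preimage hφc
  refine ⟨⟨?_, ?_⟩, ⟨?_, ?_⟩⟩
  · intro h U x hx
    exact (hJm U _).1 (aux_conv P π j hj hrange qe hqe (J U) (hJ U) x
      fun z w hw => (hJm U w).2 (h U x hx z w hw))
  · intro h U x hx z w hw
    refine (hJm U _).1 (aux_main P π hπ hπ' j hj hrange qe hqe (actA.ideal U) (J U) (hJ U)
      (fun x hx => (hJm U _).2 (h U x hx)) x hx z w ?_)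
    tauto
  · intro h U w hw
    refine (hJm U _).1 (hw (J U) (hJ U) ?_)
    rintro w' ⟨x, hx, z, hz⟩
    exact aux_main P π hπ hπ' j hj hrange qe hqe (actA.ideal U) (J U) (hJ U)
      (fun x hx => (hJm U _).2 (h U x hx)) x hx z w' hz
  · intro h U x hx
    refine h U _ fun I hI hgen => ?_
    refine aux_conv P π j hj hrange qe hqe I hI x fun z w hw => hgen ⟨x, hx, z, ?_⟩
    tauto

end
end
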